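/- arXiv:2408.14662 — 3 statements merged into one kernel-verified Lean document; each statement's English description precedes it below -/
import Mathlib

section
/- Let f, g : Ω → ℝ be real-analytic on an open set Ω ⊆ ℝ² with {f, g} = 0 near x* ∈ Ω. Suppose the order of vanishing d of f − f(x*) at x* (the least k ≥ 1 with Dᵏf(x*) ≠ 0) is odd. Then there exists a continuous function F defined near f(x*), analytic in the variable (s − f(x*))^{1/d}, such that g = F ∘ f in a neighborhood of x*. -/
noncomputable section

/-- Poisson bracket `{f, g} = ∂₁f ∂₂g − ∂₂f ∂₁g` on `ℝ²`. -/
def bracket (f g : ℝ × ℝ → ℝ) (x : ℝ × ℝ) : ℝ :=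
  fderiv ℝ f x (1, 0) * fderiv ℝ g x (0, 1) - fderiv ℝ f x (0, 1) * fderiv ℝ g x (1, 0)

/-- Degree of vanishing: least `k ≥ 1` with `Dᵏf(x) ≠ 0`. -/
def degVan (f : ℝ × ℝ → ℝ) (x : ℝ × ℝ) : ℕ :=
  sInf {k | 1 ≤ k ∧ iteratedFDeriv ℝ k f x ≠ 0}

/-- Real `d`-th root, odd extension to negative reals. -/
def oddRoot (d : ℕ) (s : ℝ) : ℝ := Real.sign s * |s| ^ ((d : ℝ)⁻¹)

open Filter Topology Polynomial

/-- `Im`-type weighted splitting of a power series into residue classes. -/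
lemma split_series (φ : ℝ → ℝ) (hφ : AnalyticAt ℝ φ 0) (d : ℕ) (hd : 0 < d) :
    ∃ ψ : ℕ → ℝ → ℝ, (∀ j, AnalyticAt ℝ (ψ j) 0) ∧
      (∀ᶠ r in 𝓝 (0:ℝ), φ r = ∑ j ∈ Finset.range d, ψ j (r ^ d) * r ^ j) ∧
      ∀ b : ℕ → ℝ, (∀ᶠ r in 𝓝 (0:ℝ), ∑ j ∈ Finset.range d, b j * (ψ j (r ^ d) * r ^ j) = 0) →
        ∀ j < d, b j ≠ 0 → ψ j = 0 := by
  obtain ⟨p, hp⟩ := hφ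
  have hp' := hasFPowerSeriesAt_iff.1 hp
  set a : ℕ → ℝ := fun n => p.coeff n with ha
  simp only [zero_add, smul_eq_mul] at hp'
  have hs : ∀ᶠ r in 𝓝 (0:ℝ), HasSum (fun n => a n * r ^ n) (φ r) := by
    filter_upwards [hp'] with r hr
    simpa [ha, mul_comm] using hr
  let ψ : ℕ → ℝ → ℝ := fun j c => ∑' k, a (j + d * k) * c ^ k
  have hψs : ∀ j, ∀ᶠ c in 𝓝 (0:ℝ), Summable (fun k => a (j + d * k) * c ^ k) := by
    intro j
    obtain ⟨ε, hε, H⟩ := Metric.eventually_nhds_iff.1 hs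
    have h1 : Summable (fun n => a n * (ε/2) ^ n) :=
      (H (y := ε/2) (by rw [Real.dist_eq, sub_zero, abs_of_pos (by positivity)]; linarith)).summable
    have h2 : Summable (fun k => |a (j + d * k) * (ε/2) ^ (j + d * k)|) := by
      have hi : Function.Injective (fun k : ℕ => j + d * k) := by
        intro x y hxy
        simpa [hd.ne'] using hxy
      exact (h1.abs.comp_injective hi)
    rw [Metric.eventually_nhds_iff]
    refine ⟨(ε/2)^d, by positivity, fun c hc => ?_⟩
    rw [Real.dist_eq, sub_zero] at hc
    refine Summable.of_norm_bounded (h2.mul_left (((ε/2)^j)⁻¹)) fun k => ?_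
    rw [Real.norm_eq_abs, abs_mul, abs_mul, abs_pow, pow_add, pow_mul, abs_mul,
      abs_of_pos (by positivity : 0 < (ε/2)^j), abs_of_pos (by positivity : 0 < ((ε/2)^d)^k)]
    have : |c|^k ≤ ((ε/2)^d)^k := by gcongr
    calc |a (j + d * k)| * |c|^k ≤ |a (j + d * k)| * ((ε/2)^d)^k := by gcongr
      _ = _ := by field_simp
  have hψa : ∀ j, AnalyticAt ℝ (ψ j) 0 := by
    intro j
    refine ⟨FormalMultilinearSeries.ofScalars ℝ (fun k => a (j + d * k)), ?_⟩
    rw [hasFPowerSeriesAt_iff]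
    filter_upwards [hψs j] with c hc
    simpa [ψ, mul_comm, FormalMultilinearSeries.coeff_ofScalars] using hc.hasSum
  have key : ∀ b : ℕ → ℝ, ∀ᶠ r in 𝓝 (0:ℝ), HasSum (fun n => b (n % d) * a n * r ^ n)
      (∑ j ∈ Finset.range d, b j * (ψ j (r ^ d) * r ^ j)) := by
    intro b
    filter_upwards [hs] with r hr
    have hsum : Summable (fun n => b (n % d) * a n * r ^ n) := by
      refine Summable.of_norm_bounded (hr.summable.abs.mul_left (∑ j ∈ Finset.range d, |b j|))
        fun n => ?_
      rw [mul_assoc, Real.norm_eq_abs, abs_mul]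
      gcongr
      exact Finset.single_le_sum (f := fun j => |b j|) (fun _ _ => abs_nonneg _)
        (Finset.mem_range.2 (Nat.mod_lt _ hd))
    have : ∑' n, b (n % d) * a n * r ^ n = ∑ j ∈ Finset.range d, b j * (ψ j (r ^ d) * r ^ j) := by
      obtain ⟨m, rfl⟩ : ∃ m, d = m + 1 := ⟨d - 1, by omega⟩
      rw [Nat.sumByResidueClasses hsum (m+1)]
      rw [← Fin.sum_univ_eq_sum_range (fun j => b j * (ψ j (r ^ (m+1)) * r ^ j))]
      refine Finset.sum_congr rfl fun j _ => ?_
      have e : ZMod.val j = Fin.val j := rfl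
      rw [e]
      have hj : Fin.val j < m + 1 := Fin.is_lt _
      generalize Fin.val j = i at hj
      simp only [ψ]
      rw [← tsum_mul_right, ← tsum_mul_left]
      refine tsum_congr fun k => ?_
      rw [Nat.add_mul_mod_self_left, Nat.mod_eq_of_lt hj, pow_add, pow_mul]
      ring
    rw [← this]
    exact hsum.hasSum
  refine ⟨ψ, hψa, ?_, ?_⟩
  · filter_upwards [hs, key (fun _ => 1)] with r h1 h2
    simp only [one_mul] at h2
    exact h1.unique h2
  · intro b hb j hj hbj
    have h1 : HasFPowerSeriesAt (fun _ : ℝ => (0:ℝ))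
        (FormalMultilinearSeries.ofScalars ℝ (fun n => b (n % d) * a n)) 0 := by
      rw [hasFPowerSeriesAt_iff]
      filter_upwards [key b, hb] with r h1 h2
      rw [h2] at h1
      simpa [mul_comm, mul_left_comm, FormalMultilinearSeries.coeff_ofScalars] using h1
    have h2 := h1.eq_zero
    have h3 : ∀ n, b (n % d) * a n = 0 := by
      intro n
      rw [← FormalMultilinearSeries.coeff_ofScalars (𝕜 := ℝ) (p := fun n => b (n % d) * a n) (n := n),
        h2]
      rfl
    funext c
    have : ∀ k, a (j + d * k) = 0 := by
      intro k
      have := h3 (j + d * k)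
      rw [Nat.add_mul_mod_self_left, Nat.mod_eq_of_lt hj] at this
      exact (mul_eq_zero.1 this).resolve_left hbj
    simp [ψ, this]

/-- eliminant -/
noncomputable def elimRes (d : ℕ) (c y : ℝ) (q : ℕ → ℝ) : ℝ :=
  resultant (X ^ d - C c : ℝ[X]) (C y - ∑ j ∈ Finset.range d, C (q j) * X ^ j) d d

lemma elimRes_eq_zero (d : ℕ) (hd : 0 < d) (c y : ℝ) (q : ℕ → ℝ) :
    elimRes d c y q = 0 ↔
      ∃ z : ℂ, z ^ d = (c:ℂ) ∧ (y:ℂ) = ∑ j ∈ Finset.range d, (q j : ℂ) * z ^ j := by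
  have h0 : elimRes d c y q = 0 ↔ ((elimRes d c y q : ℝ) : ℂ) = 0 := by simp
  have h1 : ((elimRes d c y q : ℝ) : ℂ) = resultant (X ^ d - C (c:ℂ) : ℂ[X])
      (C (y:ℂ) - ∑ j ∈ Finset.range d, C (q j : ℂ) * X ^ j) d d := by
    unfold elimRes
    have := resultant_map_map (X ^ d - C c : ℝ[X])
      (C y - ∑ j ∈ Finset.range d, C (q j) * X ^ j) d d Complex.ofRealHom
    rw [Complex.ofRealHom_eq_coe] at this
    rw [← this]
    have e1 : (X ^ d - C c : ℝ[X]).map Complex.ofRealHom = X ^ d - C (c:ℂ) := by simp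
    have e2 : (C y - ∑ j ∈ Finset.range d, C (q j) * X ^ j : ℝ[X]).map Complex.ofRealHom
        = C (y:ℂ) - ∑ j ∈ Finset.range d, C (q j : ℂ) * X ^ j := by simp [Polynomial.map_sum]
    rw [e1, e2]
  have hm : (X ^ d - C (c:ℂ) : ℂ[X]).Monic := monic_X_pow_sub_C _ hd.ne'
  have hn : (X ^ d - C (c:ℂ) : ℂ[X]).natDegree = d := natDegree_X_pow_sub_C
  have hdeg : (C (y:ℂ) - ∑ j ∈ Finset.range d, C (q j : ℂ) * X ^ j).natDegree ≤ d := by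
    refine (natDegree_sub_le _ _).trans (max_le (by simp) ?_)
    refine natDegree_sum_le_of_forall_le _ _ fun j hj => ?_
    exact (natDegree_C_mul_X_pow_le _ _).trans (Finset.mem_range.1 hj).le
  have h2 := resultant_eq_prod_eval (X ^ d - C (c:ℂ) : ℂ[X])
      (C (y:ℂ) - ∑ j ∈ Finset.range d, C (q j : ℂ) * X ^ j) d hdeg (IsAlgClosed.splits _)
  rw [hn] at h2
  rw [h0, h1, h2, hm.leadingCoeff, one_pow, one_mul, Multiset.prod_eq_zero_iff]
  simp only [Multiset.mem_map, mem_roots hm.ne_zero, IsRoot.def]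
  refine exists_congr fun z => ?_
  simp [eval_finsetSum, sub_eq_zero]

lemma elimRes_analyticAt {E : Type*} [NormedAddCommGroup E] [NormedSpace ℝ E] (d : ℕ)
    (c y : E → ℝ) (q : ℕ → E → ℝ) (x : E)
    (hc : AnalyticAt ℝ c x) (hy : AnalyticAt ℝ y x) (hq : ∀ j < d, AnalyticAt ℝ (q j) x) :
    AnalyticAt ℝ (fun x => elimRes d (c x) (y x) (fun j => q j x)) x := by
  unfold elimRes resultant
  simp only [Matrix.det_apply']
  refine Finset.analyticAt_fun_sum _ fun σ _ => analyticAt_const.mul ?_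
  refine Finset.analyticAt_fun_prod _ fun i _ => ?_
  have hA : ∀ k, AnalyticAt ℝ (fun x => (X ^ d - C (c x) : ℝ[X]).coeff k) x := by
    intro k
    simp only [coeff_sub, coeff_C, coeff_X_pow]
    refine analyticAt_const.sub ?_
    split_ifs
    exacts [hc, analyticAt_const]
  have hB : ∀ k, AnalyticAt ℝ
      (fun x => (C (y x) - ∑ j ∈ Finset.range d, C (q j x) * X ^ j : ℝ[X]).coeff k) x := by
    intro k
    simp only [coeff_sub, coeff_C, finsetSum_coeff, coeff_C_mul, coeff_X_pow]
    refine AnalyticAt.fun_sub ?_ (Finset.analyticAt_fun_sum _ fun j hj =>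
      (hq j (Finset.mem_range.1 hj)).mul analyticAt_const)
    split_ifs
    exacts [hy, analyticAt_const]
  simp only [sylvester, Matrix.of_apply]
  refine Fin.addCases (fun j => ?_) (fun j => ?_) i
  · simp only [Fin.addCases_left]
    split_ifs
    exacts [hB _, analyticAt_const]
  · simp only [Fin.addCases_right]
    split_ifs
    exacts [hA _, analyticAt_const]

lemma line_normal (f : ℝ × ℝ → ℝ) (xs : ℝ × ℝ) (hf : AnalyticAt ℝ f xs)
    (d : ℕ) (hd : d = degVan f xs) (hd0 : 0 < d) :
    ∃ v : ℝ × ℝ, ∃ k : ℝ → ℝ, AnalyticAt ℝ k 0 ∧ k 0 ≠ 0 ∧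
      ∀ t : ℝ, f (xs + t • v) - f xs = t ^ d * k t := by
  obtain ⟨p, r, hp⟩ := hf
  have hmem : d ∈ {k | 1 ≤ k ∧ iteratedFDeriv ℝ k f xs ≠ 0} := by
    rw [hd]
    exact Nat.sInf_mem (Nat.nonempty_of_pos_sInf (hd ▸ hd0 : 0 < degVan f xs))
  have hlt : ∀ k, 1 ≤ k → k < d → iteratedFDeriv ℝ k f xs = 0 := by
    intro k h1 h2
    by_contra h
    rw [hd] at h2
    exact Nat.notMem_of_lt_sInf h2 ⟨h1, h⟩
  obtain ⟨v, hv⟩ : ∃ v, p d (fun _ => v) ≠ 0 := by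
    by_contra! h
    apply hmem.2
    ext w
    rw [hp.iteratedFDeriv_eq_sum_of_completeSpace, ← (p d).iteratedFDeriv_comp_diagonal 0 w]
    have : (fun x => p d (fun _ => x)) = fun _ => 0 := funext h
    rw [this]
    simp [iteratedFDeriv_const_of_ne (𝕜 := ℝ) hd0.ne']
  let c : ℕ → ℝ := fun n => if n = 0 then 0 else p n (fun _ => v)
  let q := FormalMultilinearSeries.ofScalars ℝ c
  have hq : ∀ n, q n = 0 ↔ c n = 0 := by
    intro n
    rw [← FormalMultilinearSeries.coeff_ofScalars (p := c) (n := n),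
      FormalMultilinearSeries.coeff_eq_zero]
  have hcd : c d ≠ 0 := by simpa [c, hd0.ne'] using hv
  have hclt : ∀ k < d, c k = 0 := by
    intro k hk
    by_cases h0 : k = 0
    · simp [c, h0]
    · have := hp.factorial_smul v k
      rw [hlt k (by omega) hk] at this
      have h2 : p k (fun _ => v) = 0 := by simpa [Nat.factorial_ne_zero] using this
      simp [c, h2]
  have hq0 : q ≠ 0 := fun h => hcd ((hq d).1 (by rw [h]; rfl))
  have hord : q.order = d := by
    apply le_antisymm
    · by_contra! h
      exact hcd ((hq d).1 (q.apply_eq_zero_of_lt_order h))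
    · by_contra! h
      exact q.apply_order_ne_zero hq0 ((hq _).2 (hclt _ h))
  have hser : HasFPowerSeriesAt (fun t : ℝ => f (xs + t • v) - f xs) q 0 := by
    rw [hasFPowerSeriesAt_iff]
    have hc : Tendsto (fun t : ℝ => t • v) (𝓝 0) (𝓝 0) := by
      have : Continuous (fun t : ℝ => t • v) := by fun_prop
      simpa using this.tendsto 0
    filter_upwards [hc (Metric.eball_mem_nhds 0 hp.r_pos)] with t ht
    have h1 := hp.hasSum ht
    have h2 := h1.sub (hasSum_ite_eq 0 (f xs))
    simp only [zero_add, q, FormalMultilinearSeries.coeff_ofScalars]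
    convert! h2 using 2 with n
    by_cases h0 : n = 0
    · subst h0
      simp [c, hp.coeff_zero]
    · simp only [c, h0, if_false, sub_zero]
      have := (p n).map_smul_univ (fun _ => t) (fun _ => v)
      simp at this
      simp [this]
  refine ⟨v, (Function.swap dslope 0)^[d] (fun t : ℝ => f (xs + t • v) - f xs), ?_, ?_, ?_⟩
  · exact ⟨_, hser.has_fpower_series_iterate_dslope_fslope d⟩
  · rw [← hord]; exact hser.iterate_dslope_fslope_ne_zero hq0
  · intro t
    have := hser.eq_pow_order_mul_iterate_dslope t
    rw [hord] at this
    simpa using this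

lemma exists_root (k : ℝ → ℝ) (hk : AnalyticAt ℝ k 0) (h0 : k 0 ≠ 0) (d : ℕ) (hodd : Odd d) :
    ∃ u : ℝ → ℝ, AnalyticAt ℝ u 0 ∧ u 0 = 0 ∧ deriv u 0 ≠ 0 ∧
      ∀ᶠ t in 𝓝 (0:ℝ), u t ^ d = t ^ d * k t := by
  obtain ⟨σ, hσ, hσk⟩ : ∃ σ : ℝ, (σ = 1 ∨ σ = -1) ∧ 0 < σ * k 0 := by
    rcases lt_or_gt_of_ne h0 with h | h
    · exact ⟨-1, Or.inr rfl, by linarith⟩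
    · exact ⟨1, Or.inl rfl, by linarith⟩
  have hσd : σ ^ d = σ := by
    rcases hσ with rfl | rfl
    · simp
    · exact hodd.neg_one_pow
  have hσσ : σ * σ = 1 := by rcases hσ with rfl | rfl <;> norm_num
  have hd0 : (d:ℝ) ≠ 0 := by exact_mod_cast hodd.pos.ne'
  let K : ℝ → ℝ := fun t => σ * Real.exp (Real.log (σ * k t) / d)
  have hsk : AnalyticAt ℝ (fun t => σ * k t) 0 := analyticAt_const.mul hk
  have hK : AnalyticAt ℝ K 0 :=
    analyticAt_const.mul ((AnalyticAt.div (hsk.log hσk) analyticAt_const hd0).rexp')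
  have hK0 : K 0 ≠ 0 := by
    have : σ ≠ 0 := fun h => by simp [h] at hσσ
    exact mul_ne_zero this (Real.exp_pos _).ne'
  refine ⟨fun t => t * K t, analyticAt_id.mul hK, by simp, ?_, ?_⟩
  · have := (hasDerivAt_id (0:ℝ)).mul hK.differentiableAt.hasDerivAt
    have h2 : deriv (fun t => t * K t) 0 = _ := this.deriv
    rw [h2]; simpa using hK0
  · filter_upwards [hsk.continuousAt.eventually (lt_mem_nhds hσk)] with t ht
    have ht : 0 < σ * k t := ht
    rw [mul_pow]
    congr 1
    simp only [K]
    rw [mul_pow, ← Real.exp_nat_mul, mul_div_cancel₀ _ hd0, Real.exp_log ht, hσd, ← mul_assoc, hσσ,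
      one_mul]

lemma oddRoot_pow {d : ℕ} (hodd : Odd d) (s : ℝ) : oddRoot d s ^ d = s := by
  unfold oddRoot
  have hd : d ≠ 0 := hodd.pos.ne'
  rw [mul_pow, Real.rpow_inv_natCast_pow (abs_nonneg s) hd]
  rcases lt_trichotomy s 0 with h | h | h
  · rw [Real.sign_of_neg h, hodd.neg_one_pow, abs_of_neg h]; ring
  · simp [h]
  · rw [Real.sign_of_pos h, one_pow, abs_of_pos h]; ring

lemma oddRoot_unique {d : ℕ} (hodd : Odd d) (r : ℝ) : oddRoot d (r ^ d) = r :=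
  hodd.strictMono_pow.injective (oddRoot_pow hodd (r ^ d))

lemma oddRoot_tendsto {d : ℕ} (hodd : Odd d) : Tendsto (oddRoot d) (𝓝 0) (𝓝 0) := by
  have hd : d ≠ 0 := hodd.pos.ne'
  rw [Metric.tendsto_nhds_nhds]
  intro ε hε
  refine ⟨ε ^ d, by positivity, fun {s} hs => ?_⟩
  simp only [dist_zero_right, Real.norm_eq_abs] at *
  rw [← oddRoot_pow hodd s, abs_pow] at hs
  exact lt_of_pow_lt_pow_left₀ _ hε.le hs

lemma bracket_lin (f g : ℝ × ℝ → ℝ) (z a b : ℝ × ℝ) (h : bracket f g z = 0) :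
    fderiv ℝ f z a * fderiv ℝ g z b = fderiv ℝ f z b * fderiv ℝ g z a := by
  have key : ∀ (T : ℝ × ℝ →L[ℝ] ℝ) (y : ℝ × ℝ), T y = y.1 * T (1,0) + y.2 * T (0,1) := by
    intro T y
    have : y = y.1 • ((1:ℝ),(0:ℝ)) + y.2 • ((0:ℝ),(1:ℝ)) := by ext <;> simp
    calc T y = T (y.1 • ((1:ℝ),(0:ℝ)) + y.2 • ((0:ℝ),(1:ℝ))) := by rw [← this]
      _ = _ := by rw [map_add, map_smul, map_smul]; rfl
  unfold bracket at h
  rw [key (fderiv ℝ f z) a, key (fderiv ℝ f z) b, key (fderiv ℝ g z) a, key (fderiv ℝ g z) b]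
  linear_combination (a.1 * b.2 - a.2 * b.1) * h

lemma local_factor (f g : ℝ × ℝ → ℝ) (x0 v : ℝ × ℝ) (hf : AnalyticAt ℝ f x0)
    (hg : AnalyticAt ℝ g x0) (hbr : ∀ᶠ x in 𝓝 x0, bracket f g x = 0)
    (hv : fderiv ℝ f x0 v ≠ 0) (ε : ℝ) (hε : 0 < ε) :
    ∀ᶠ x in 𝓝 x0, ∃ s : ℝ, |s| < ε ∧ f (x0 + s • v) = f x ∧ g (x0 + s • v) = g x := by
  have hv0 : v ≠ 0 := by rintro rfl; simp at hv
  let L : ℝ × ℝ →L[ℝ] ℝ :=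
    v.1 • ContinuousLinearMap.snd ℝ ℝ ℝ - v.2 • ContinuousLinearMap.fst ℝ ℝ ℝ
  have hL : ∀ y, L y = v.1 * y.2 - v.2 * y.1 := fun y => by simp [L]
  have hLker : ∀ y, L y = 0 → ∃ s : ℝ, y = s • v := by
    intro y hy
    rw [hL] at hy
    by_cases h1 : v.1 = 0
    · have h2 : v.2 ≠ 0 := fun h2 => hv0 (Prod.ext h1 h2)
      refine ⟨y.2 / v.2, Prod.ext ?_ ?_⟩
      · rw [h1] at hy
        have : y.1 = 0 := by simpa [h2] using hy
        simp [h1, this]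
      · simp [h2]
    · refine ⟨y.1 / v.1, Prod.ext ?_ ?_⟩
      · simp [h1]
      · simp; field_simp; linarith
  let Ψ : ℝ × ℝ → ℝ × ℝ := fun x => (f x, L x)
  have hΨa : AnalyticAt ℝ Ψ x0 := hf.prod (L.analyticAt x0)
  let D : ℝ × ℝ →L[ℝ] ℝ × ℝ := (fderiv ℝ f x0).prod L
  have hΨfd : ∀ z, DifferentiableAt ℝ f z → HasFDerivAt Ψ ((fderiv ℝ f z).prod L) z := fun z hz =>
    hz.hasFDerivAt.prodMk L.hasFDerivAt
  have hDinj : Function.Injective D := by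
    rw [injective_iff_map_eq_zero]
    intro y hy
    have h1 : fderiv ℝ f x0 y = 0 := congrArg Prod.fst hy
    have h2 : L y = 0 := congrArg Prod.snd hy
    obtain ⟨s, rfl⟩ := hLker y h2
    have : s = 0 := by simpa [hv] using h1
    simp [this]
  let i : (ℝ × ℝ) ≃L[ℝ] (ℝ × ℝ) :=
    (LinearEquiv.ofInjectiveEndo (D : ℝ × ℝ →ₗ[ℝ] ℝ × ℝ) hDinj).toContinuousLinearEquiv
  have hi : (i : ℝ × ℝ →L[ℝ] ℝ × ℝ) = D := by ext <;> rfl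
  have hfdΨ : fderiv ℝ Ψ x0 = i := by rw [hi]; exact (hΨfd x0 hf.differentiableAt).fderiv
  have hst : HasStrictFDerivAt Ψ (i : ℝ × ℝ →L[ℝ] ℝ × ℝ) x0 := by
    rw [← hfdΨ]; exact hΨa.hasStrictFDerivAt
  let e := hst.toOpenPartialHomeomorph Ψ
  have hex : x0 ∈ e.source := hst.mem_toOpenPartialHomeomorph_source
  have hee : ∀ x, e x = Ψ x := fun x => rfl
  have hesa : AnalyticAt ℝ e.symm (Ψ x0) := e.analyticAt_symm' hex hΨa hfdΨ
  have hes0 : e.symm (Ψ x0) = x0 := e.left_inv hex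
  have hcont : Tendsto e.symm (𝓝 (Ψ x0)) (𝓝 x0) := by
    have := hesa.continuousAt.tendsto
    rwa [hes0] at this
  have hfv : ∀ᶠ z in 𝓝 x0, fderiv ℝ f z v ≠ 0 := by
    have : ContinuousAt (fun z => fderiv ℝ f z v) x0 :=
      (hf.fderiv.continuousAt).clm_apply continuousAt_const
    exact this.eventually_ne hv
  have hball : ∀ᶠ z in 𝓝 x0, dist z x0 < ε * ‖v‖ :=
    Metric.ball_mem_nhds x0 (by positivity)
  have hgood : ∀ᶠ y in 𝓝 (Ψ x0), DifferentiableAt ℝ e.symm y ∧ Ψ (e.symm y) = y ∧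
      DifferentiableAt ℝ f (e.symm y) ∧ DifferentiableAt ℝ g (e.symm y) ∧
      bracket f g (e.symm y) = 0 ∧ fderiv ℝ f (e.symm y) v ≠ 0 ∧
      dist (e.symm y) x0 < ε * ‖v‖ := by
    filter_upwards [hesa.eventually_analyticAt, e.open_target.mem_nhds (e.map_source hex),
      hcont.eventually hf.eventually_analyticAt, hcont.eventually hg.eventually_analyticAt,
      hcont.eventually hbr, hcont.eventually hfv, hcont.eventually hball]
      with y h1 h2 h3 h4 h5 h6 h7
    exact ⟨h1.differentiableAt, e.right_inv h2, h3.differentiableAt, h4.differentiableAt, h5, h6, h7⟩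
  obtain ⟨δ, hδ, hB'⟩ := Metric.eventually_nhds_iff_ball.1 (hgood.eventually_nhds)
  have hB := fun y hy => (hB' y hy).self_of_nhds
  have hder : ∀ y ∈ Metric.ball (Ψ x0) δ, fderiv ℝ (fun y => g (e.symm y)) y (0, 1) = 0 := by
    intro y hy
    obtain ⟨h1, h2, h3, h4, h5, h6, h7⟩ := hB y hy
    have hc1 : HasFDerivAt (fun y => g (e.symm y)) ((fderiv ℝ g (e.symm y)).comp (fderiv ℝ e.symm y)) y :=
      h4.hasFDerivAt.comp y h1.hasFDerivAt
    have hc2 : HasFDerivAt (fun y => f (e.symm y)) ((fderiv ℝ f (e.symm y)).comp (fderiv ℝ e.symm y)) y :=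
      h3.hasFDerivAt.comp y h1.hasFDerivAt
    have hc3 : HasFDerivAt (fun y => f (e.symm y)) (ContinuousLinearMap.fst ℝ ℝ ℝ) y := by
      refine (ContinuousLinearMap.fst ℝ ℝ ℝ).hasFDerivAt.congr_of_eventuallyEq ?_
      filter_upwards [hB' y hy] with w hw
      exact congrArg Prod.fst hw.2.1
    have h8 : fderiv ℝ f (e.symm y) (fderiv ℝ e.symm y (0, 1)) = 0 := by
      have := congrArg (fun T : ℝ × ℝ →L[ℝ] ℝ => T (0, 1)) (hc2.unique hc3)
      simpa using this
    rw [hc1.fderiv]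
    have := bracket_lin f g (e.symm y) v (fderiv ℝ e.symm y (0, 1)) h5
    rw [h8, zero_mul] at this
    exact (mul_eq_zero.1 this).resolve_left h6
  filter_upwards [hΨa.continuousAt.preimage_mem_nhds (Metric.ball_mem_nhds _ hδ),
    e.open_source.mem_nhds hex] with x hx hxs
  have hx : Ψ x ∈ Metric.ball (Ψ x0) δ := hx
  have hx12 : dist (f x) (f x0) < δ ∧ dist (L x) (L x0) < δ := by
    simpa [Ψ, Prod.dist_eq] using hx
  have hmem : ∀ s ∈ Metric.ball (L x0) δ, (f x, s) ∈ Metric.ball (Ψ x0) δ := by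
    intro s hs
    rw [Metric.mem_ball, Prod.dist_eq]
    exact max_lt hx12.1 hs
  have hdd : ∀ s ∈ Metric.ball (L x0) δ, HasDerivAt (fun s => g (e.symm (f x, s))) 0 s := by
    intro s hs
    obtain ⟨h1, h2, h3, h4, h5, h6, h7⟩ := hB _ (hmem s hs)
    have hc1 : DifferentiableAt ℝ (fun y => g (e.symm y)) (f x, s) := h4.comp _ h1
    have hc2 : HasDerivAt (fun s : ℝ => (f x, s)) (0, 1) s :=
      (hasDerivAt_const s (f x)).prodMk (hasDerivAt_id s)
    have := hc1.hasFDerivAt.comp_hasDerivAt s hc2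
    rw [hder _ (hmem s hs)] at this
    exact this
  have hconst : g (e.symm (f x, L x)) = g (e.symm (f x, L x0)) :=
    Metric.isOpen_ball.is_const_of_deriv_eq_zero (𝕜 := ℝ) (f := fun s => g (e.symm (f x, s)))
      (convex_ball (L x0) δ).isPreconnected
      (fun s hs => (hdd s hs).differentiableAt.differentiableWithinAt)
      (fun s hs => (hdd s hs).deriv) hx12.2 (Metric.mem_ball_self hδ)
  have hxx : e.symm (f x, L x) = x := e.left_inv hxs
  rw [hxx] at hconst
  obtain ⟨h1, h2, h3, h4, h5, h6, h7⟩ := hB _ (hmem (L x0) (Metric.mem_ball_self hδ))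
  set z := e.symm (f x, L x0)
  have hz1 : f z = f x := congrArg Prod.fst h2
  have hz2 : L z = L x0 := congrArg Prod.snd h2
  obtain ⟨s, hs⟩ := hLker (z - x0) (by rw [map_sub, hz2, sub_self])
  have hzs : x0 + s • v = z := by rw [← hs]; abel
  refine ⟨s, ?_, by rw [hzs, hz1], by rw [hzs, hconst]⟩
  rw [dist_eq_norm, hs, norm_smul, Real.norm_eq_abs] at h7
  exact lt_of_mul_lt_mul_right h7 (norm_nonneg v)

lemma root_real (d : ℕ) (hodd : Odd d) (φ : ℝ → ℝ) (ψ : ℕ → ℝ → ℝ)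
    (hψ : ∀ j, AnalyticAt ℝ (ψ j) 0)
    (hsum : ∀ᶠ r in 𝓝 (0:ℝ), φ r = ∑ j ∈ Finset.range d, ψ j (r ^ d) * r ^ j)
    (hw : ∀ b : ℕ → ℝ, (∀ᶠ r in 𝓝 (0:ℝ), ∑ j ∈ Finset.range d, b j * (ψ j (r ^ d) * r ^ j) = 0) →
        ∀ j < d, b j ≠ 0 → ψ j = 0)
    (w : ℂ) (hwd : w ^ d = 1) :
    ∀ᶠ r in 𝓝 (0:ℝ), ∀ y : ℝ,
      (y:ℂ) = ∑ j ∈ Finset.range d, (ψ j (r ^ d) : ℂ) * ((r:ℂ) * w) ^ j → y = φ r := by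
  have hd := hodd.pos
  let S : ℝ → ℝ := fun r => ∑ j ∈ Finset.range d, (w ^ j).im * (ψ j (r ^ d) * r ^ j)
  have hSim : ∀ r : ℝ, (∑ j ∈ Finset.range d, (ψ j (r ^ d) : ℂ) * ((r:ℂ) * w) ^ j).im = S r := by
    intro r
    rw [Complex.im_sum]
    refine Finset.sum_congr rfl fun j _ => ?_
    rw [mul_pow, ← mul_assoc, ← Complex.ofReal_pow, ← Complex.ofReal_mul, Complex.im_ofReal_mul]
    ring
  have hSa : AnalyticAt ℝ S 0 := by
    refine Finset.analyticAt_fun_sum _ fun j _ => analyticAt_const.mul (AnalyticAt.fun_mul ?_ ?_)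
    · have h1 : AnalyticAt ℝ (fun r : ℝ => r ^ d) 0 := analyticAt_id.pow d
      have h2 : AnalyticAt ℝ (ψ j) ((fun r : ℝ => r ^ d) 0) := by
        simpa [hd.ne'] using hψ j
      exact AnalyticAt.comp (g := ψ j) (f := fun r : ℝ => r ^ d) h2 h1
    · exact analyticAt_id.pow j
  rcases hSa.eventually_eq_zero_or_eventually_ne_zero with h | h
  · have h1 := hw (fun j => (w ^ j).im) h
    filter_upwards [hsum] with r hr y hy
    rw [hr]
    apply Complex.ofReal_injective
    rw [hy]
    push_cast
    refine Finset.sum_congr rfl fun j hj => ?_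
    by_cases him : (w ^ j).im = 0
    · have hre : w ^ j = ((w ^ j).re : ℂ) := Complex.ext rfl (by simpa using him)
      have h2 : (w ^ j) ^ d = 1 := by rw [← pow_mul, mul_comm, pow_mul, hwd, one_pow]
      rw [hre] at h2
      have h3 : (w ^ j).re ^ d = 1 := by exact_mod_cast h2
      have h4 : (w ^ j).re = 1 := hodd.strictMono_pow.injective (by simpa using h3)
      rw [h4] at hre
      rw [mul_pow, hre]
      simp
    · rw [h1 j (Finset.mem_range.1 hj) him]
      simp
  · rw [eventually_nhdsWithin_iff] at h
    filter_upwards [h, hsum] with r h1 hr y hy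
    by_cases h0 : r = 0
    · subst h0
      rw [hr]
      apply Complex.ofReal_injective
      rw [hy]
      push_cast
      refine Finset.sum_congr rfl fun j hj => ?_
      by_cases hj0 : j = 0
      · simp [hj0]
      · simp [hj0]
    · exfalso
      apply h1 h0
      rw [← hSim r, ← hy, Complex.ofReal_im]

theorem stmt2 (Ω : Set (ℝ × ℝ)) (hΩ : IsOpen Ω) (f g : ℝ × ℝ → ℝ)
    (xs : ℝ × ℝ) (hxs : xs ∈ Ω)
    (hf : AnalyticOnNhd ℝ f Ω) (hg : AnalyticOnNhd ℝ g Ω)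
    (hbr : ∀ᶠ x in nhds xs, bracket f g x = 0)
    (d : ℕ) (hd : d = degVan f xs) (hodd : Odd d) :
    ∃ φ : ℝ → ℝ, AnalyticAt ℝ φ 0 ∧
      ∃ F : ℝ → ℝ, (F = fun s => φ (oddRoot d (s - f xs))) ∧
        ContinuousAt F (f xs) ∧
        ∀ᶠ x in nhds xs, g x = F (f x) := by
  have hd0 : 0 < d := hodd.pos
  have hfx := hf xs hxs
  have hgx := hg xs hxs
  obtain ⟨v, k, hk, hk0, hline⟩ := line_normal f xs hfx d hd hd0
  obtain ⟨u, hu, hu0, hu', hud⟩ := exists_root k hk hk0 d hodd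
  let ρ := hu.hasStrictDerivAt.localInverse _ _ _ hu'
  have hρa : AnalyticAt ℝ ρ 0 := by
    have := hu.analyticAt_localInverse hu'
    rwa [hu0] at this
  have hρu : ∀ᶠ t in 𝓝 (0:ℝ), ρ (u t) = t :=
    hu.hasStrictDerivAt.eventually_left_inverse hu'
  have hρ0 : ρ 0 = 0 := by
    have := hρu.self_of_nhds
    rwa [hu0] at this
  let φ : ℝ → ℝ := fun r => g (xs + ρ r • v)
  have hφ : AnalyticAt ℝ φ 0 := by
    have h1 : AnalyticAt ℝ (fun r => xs + ρ r • v) 0 :=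
      analyticAt_const.add (hρa.smul analyticAt_const)
    have h2 : AnalyticAt ℝ g ((fun r => xs + ρ r • v) 0) := by simpa [hρ0] using hgx
    exact AnalyticAt.comp (g := g) (f := fun r => xs + ρ r • v) h2 h1
  have hφu : ∀ᶠ t in 𝓝 (0:ℝ), φ (u t) = g (xs + t • v) := by
    filter_upwards [hρu] with t ht
    simp only [φ, ht]
  obtain ⟨ψ, hψ, hsum, hw⟩ := split_series φ hφ d hd0
  refine ⟨φ, hφ, _, rfl, ?_, ?_⟩
  · have h1 : Tendsto (fun s => s - f xs) (𝓝 (f xs)) (𝓝 0) := by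
      have : Continuous (fun s => s - f xs) := by fun_prop
      simpa using this.tendsto (f xs)
    have h2 : Tendsto (fun s => φ (oddRoot d (s - f xs))) (𝓝 (f xs)) (𝓝 (φ 0)) :=
      hφ.continuousAt.tendsto.comp ((oddRoot_tendsto hodd).comp h1)
    have h3 : oddRoot d (f xs - f xs) = 0 := by simp [oddRoot]
    rw [ContinuousAt, h3]
    exact h2
  have hf0 : Tendsto (fun x => f x - f xs) (𝓝 xs) (𝓝 0) := by
    have := hfx.continuousAt.tendsto.sub_const (f xs)
    simpa using this
  let H : ℝ × ℝ → ℝ := fun x => elimRes d (f x - f xs) (g x) (fun j => ψ j (f x - f xs))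
  have hψev : ∀ᶠ c in 𝓝 (0:ℝ), ∀ j ∈ Finset.range d, AnalyticAt ℝ (ψ j) c :=
    (Filter.eventually_all_finset _).2 fun j _ => (hψ j).eventually_analyticAt
  obtain ⟨ε, hε, hB⟩ := Metric.eventually_nhds_iff_ball.1
    ((hfx.eventually_analyticAt.and hgx.eventually_analyticAt).and
      ((hf0.eventually hψev).and hbr.eventually_nhds))
  have hHa : AnalyticOnNhd ℝ H (Metric.ball xs ε) := by
    intro x hx
    obtain ⟨⟨h1, h2⟩, h3, h4⟩ := hB x hx
    have h5 : AnalyticAt ℝ (fun x => f x - f xs) x := h1.sub analyticAt_const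
    refine elimRes_analyticAt d _ _ (fun j x => ψ j (f x - f xs)) x h5 h2 fun j hj => ?_
    exact AnalyticAt.comp (g := ψ j) (h3 j (Finset.mem_range.2 hj)) h5
  -- the set of good parameters on the line
  have hlc : Tendsto (fun t : ℝ => xs + t • v) (𝓝 0) (𝓝 xs) := by
    have : Continuous (fun t : ℝ => xs + t • v) := by fun_prop
    simpa using this.tendsto 0
  have hu0t : Tendsto u (𝓝 0) (𝓝 0) := by
    have := hu.continuousAt.tendsto
    rwa [hu0] at this
  have hkd : ∀ᶠ t in 𝓝 (0:ℝ), (d:ℝ) * k t + t * deriv k t ≠ 0 := by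
    have hc : ContinuousAt (fun t => (d:ℝ) * k t + t * deriv k t) 0 :=
      (continuousAt_const.mul hk.continuousAt).add (continuousAt_id.mul hk.deriv.continuousAt)
    refine hc.eventually_ne ?_
    have : (d:ℝ) ≠ 0 := by exact_mod_cast hd0.ne'
    simp [this, hk0]
  have hgoodt := (hlc.eventually (Metric.ball_mem_nhds xs hε)).and
    (hφu.and (hud.and ((hu0t.eventually hsum).and (hkd.and hk.eventually_analyticAt))))
  obtain ⟨η, hη, hG⟩ := Metric.eventually_nhds_iff_ball.1 hgoodt
  have ht0 : η / 2 ∈ Metric.ball (0:ℝ) η := by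
    rw [Metric.mem_ball, Real.dist_eq, sub_zero, abs_of_pos (by positivity)]; linarith
  set t0 : ℝ := η / 2 with ht0def
  have ht0pos : 0 < t0 := by positivity
  obtain ⟨hx0, -, -, -, hkd0, hka0⟩ := hG t0 ht0
  have hx0 : xs + t0 • v ∈ Metric.ball xs ε := hx0
  obtain ⟨⟨hfa, hga⟩, -, hbr0⟩ := hB _ hx0
  have hfv : fderiv ℝ f (xs + t0 • v) v ≠ 0 := by
    have h1 : HasDerivAt (fun t : ℝ => xs + t • v) v t0 := by
      simpa using ((hasDerivAt_id t0).smul_const v).const_add xs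
    have h2 : HasDerivAt (fun t : ℝ => f (xs + t • v)) (fderiv ℝ f (xs + t0 • v) v) t0 :=
      hfa.differentiableAt.hasFDerivAt.comp_hasDerivAt t0 h1
    have h3 : (fun t : ℝ => f (xs + t • v)) = fun t => t ^ d * k t + f xs := by
      funext t; rw [← hline t]; ring
    have h4 : HasDerivAt (fun t => t ^ d * k t + f xs)
        ((d * t0 ^ (d - 1)) * k t0 + t0 ^ d * deriv k t0) t0 :=
      ((hasDerivAt_pow d t0).mul hka0.differentiableAt.hasDerivAt).add_const (f xs)
    rw [h3] at h2
    rw [h2.unique h4]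
    have h5 : (d * t0 ^ (d - 1)) * k t0 + t0 ^ d * deriv k t0
        = t0 ^ (d - 1) * (d * k t0 + t0 * deriv k t0) := by
      obtain ⟨m, rfl⟩ : ∃ m, d = m + 1 := ⟨d - 1, by omega⟩
      rw [Nat.add_sub_cancel, pow_succ]
      ring
    rw [h5]
    exact mul_ne_zero (pow_ne_zero _ ht0pos.ne') hkd0
  have hH0 : H =ᶠ[𝓝 (xs + t0 • v)] 0 := by
    filter_upwards [local_factor f g (xs + t0 • v) v hfa hga hbr0 hfv (η / 2) (by positivity)]
      with x hx
    obtain ⟨s, hs, hfs, hgs⟩ := hx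
    have e1 : xs + t0 • v + s • v = xs + (t0 + s) • v := by rw [add_smul, add_assoc]
    rw [e1] at hfs hgs
    have htm : t0 + s ∈ Metric.ball (0:ℝ) η := by
      rw [Metric.mem_ball, Real.dist_eq, sub_zero]
      rw [abs_lt] at hs ⊢
      constructor <;> linarith [hs.1, hs.2]
    obtain ⟨-, h1, h2, h3, -, -⟩ := hG _ htm
    have h4 := hline (t0 + s)
    rw [hfs, ← h2] at h4
    change elimRes d (f x - f xs) (g x) (fun j => ψ j (f x - f xs)) = 0
    rw [elimRes_eq_zero d hd0]
    refine ⟨(u (t0 + s) : ℂ), by rw [h4]; push_cast; rfl, ?_⟩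
    rw [← hgs, ← h1, h3, h4]
    push_cast
    rfl
  have hHz := hHa.eqOn_zero_of_preconnected_of_eventuallyEq_zero
    (convex_ball xs ε).isPreconnected hx0 hH0
  -- conclusion
  have hroots : ∀ᶠ r in 𝓝 (0:ℝ), ∀ w ∈ Polynomial.nthRootsFinset d (1:ℂ), ∀ y : ℝ,
      (y:ℂ) = ∑ j ∈ Finset.range d, (ψ j (r ^ d) : ℂ) * ((r:ℂ) * w) ^ j → y = φ r :=
    (Filter.eventually_all_finset _).2 fun w hwm =>
      root_real d hodd φ ψ hψ hsum hw w ((Polynomial.mem_nthRootsFinset hd0 1).1 hwm)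
  filter_upwards [Metric.ball_mem_nhds xs hε,
    ((oddRoot_tendsto hodd).comp hf0).eventually hroots] with x hx hr
  have hHx : elimRes d (f x - f xs) (g x) (fun j => ψ j (f x - f xs)) = 0 := hHz hx
  obtain ⟨z, hz, hy⟩ := (elimRes_eq_zero d hd0 _ _ _).1 hHx
  simp only [Function.comp] at hr
  have hrp := oddRoot_pow hodd (f x - f xs)
  set r := oddRoot d (f x - f xs)
  have hzr : ∃ w : ℂ, w ^ d = 1 ∧ z = r * w := by
    by_cases h0 : r = 0
    · refine ⟨1, one_pow _, ?_⟩
      rw [← hrp, h0] at hz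
      have : z ^ d = 0 := by simpa [hd0.ne'] using hz
      simp [h0, pow_eq_zero_iff hd0.ne' |>.1 this]
    · have h0' : (r:ℂ) ≠ 0 := by exact_mod_cast h0
      refine ⟨z / r, ?_, by field_simp⟩
      rw [div_pow, hz, ← hrp]
      push_cast
      exact div_self (pow_ne_zero _ h0')
  obtain ⟨w, hw1, rfl⟩ := hzr
  refine hr w ((Polynomial.mem_nthRootsFinset hd0 1).2 hw1) (g x) ?_
  rw [hrp]
  exact hy
end
end

section
/- Let f be real-analytic near x⁰ ∈ ℝ² with f(x⁰) = 0, and suppose there is a real-analytic curve Γ₁ : [0,1] → ℝ² with Γ₁(0) = x⁰ such that every point x on Γ₁ has degree of vanishing d_f(x) = m (i.e., all derivatives of order < m vanish and some derivative of order m does not). Then in a neighborhood of x⁰, the level set {x : f(x) = 0} coincides with a single real-analytic curve Γ passing through x⁰, and every point of Γ has d_f = m. -/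
noncomputable section

open Filter Topology

lemma degVan_spec {f : ℝ × ℝ → ℝ} {x : ℝ × ℝ} {m : ℕ} (hm : 1 ≤ m) (h : degVan f x = m) :
    iteratedFDeriv ℝ m f x ≠ 0 ∧ ∀ j, 1 ≤ j → j < m → iteratedFDeriv ℝ j f x = 0 := by
  have hne : {k | 1 ≤ k ∧ iteratedFDeriv ℝ k f x ≠ 0}.Nonempty := by
    apply Nat.nonempty_of_pos_sInf
    unfold degVan at h
    omega
  refine ⟨?_, fun j hj hjm => ?_⟩
  · have := Nat.sInf_mem hne
    unfold degVan at h
    rw [h] at this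
    exact this.2
  · by_contra hc
    have : degVan f x ≤ j := Nat.sInf_le ⟨hj, hc⟩
    omega

lemma degVan_eq {f : ℝ × ℝ → ℝ} {x : ℝ × ℝ} {m : ℕ} (hm : 1 ≤ m)
    (h1 : iteratedFDeriv ℝ m f x ≠ 0) (h2 : ∀ j, j < m → iteratedFDeriv ℝ j f x = 0) :
    degVan f x = m := by
  apply le_antisymm
  · exact Nat.sInf_le ⟨hm, h1⟩
  · refine le_csInf ⟨m, hm, h1⟩ ?_
    rintro k ⟨_, hk⟩
    by_contra hc
    exact hk (h2 k (by omega))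

lemma exists_diag_ne {f : ℝ × ℝ → ℝ} {x : ℝ × ℝ} {m : ℕ} (hf : AnalyticAt ℝ f x)
    (h : iteratedFDeriv ℝ m f x ≠ 0) :
    ∃ v, iteratedFDeriv ℝ m f x (fun _ => v) ≠ 0 := by
  by_contra! hc
  apply h
  ext w
  have h1 := (iteratedFDeriv ℝ m f x).iteratedFDeriv_comp_diagonal x w
  have h2 : (fun y => iteratedFDeriv ℝ m f x (fun _ => y)) = fun _ => (0 : ℝ) := funext hc
  rw [h2] at h1
  have h3 : ∀ σ : Equiv.Perm (Fin m),
      iteratedFDeriv ℝ m f x (fun i => w (σ i)) = iteratedFDeriv ℝ m f x w :=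
    fun σ => hf.contDiffAt.iteratedFDeriv_comp_perm w σ
  simp only [h3] at h1
  have h4 : iteratedFDeriv ℝ m (fun _ : ℝ × ℝ => (0 : ℝ)) x w = 0 := by
    have : iteratedFDeriv ℝ m (fun _ : ℝ × ℝ => (0 : ℝ)) = 0 := iteratedFDeriv_fun_zero
    rw [this]; rfl
  rw [h4] at h1
  rw [Finset.sum_const, nsmul_eq_mul] at h1
  have h5 : ((Finset.univ : Finset (Equiv.Perm (Fin m))).card : ℝ) ≠ 0 := by
    rw [Finset.card_univ, Fintype.card_perm]
    positivity
  exact (mul_eq_zero.1 h1.symm).resolve_left h5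

lemma hasDerivAt_diag {f : ℝ × ℝ → ℝ} (p u : ℝ × ℝ) (j : ℕ) (r : ℝ)
    (hf : AnalyticAt ℝ f (p + r • u)) :
    HasDerivAt (fun r : ℝ => iteratedFDeriv ℝ j f (p + r • u) (fun _ => u))
      (iteratedFDeriv ℝ (j + 1) f (p + r • u) (fun _ => u)) r := by
  have hd : DifferentiableAt ℝ (iteratedFDeriv ℝ j f) (p + r • u) := by
    have : AnalyticOnNhd ℝ f {p + r • u} := by
      intro y hy; rw [Set.mem_singleton_iff] at hy; rw [hy]; exact hf
    exact ((this.iteratedFDeriv j) _ rfl).differentiableAt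
  have h1 : DifferentiableAt ℝ (fun y => iteratedFDeriv ℝ j f y (fun _ => u)) (p + r • u) := by
    exact hd.continuousMultilinear_apply_const _
  have h2 := hd.iteratedFDeriv_succ_apply_left' (m := fun _ => u)
  have h3 : HasDerivAt (fun r : ℝ => p + r • u) u r := by
    simpa using ((hasDerivAt_id r).smul_const u).const_add p
  rw [h2]
  exact h1.hasFDerivAt.comp_hasDerivAt r h3

lemma rolle_diag {f : ℝ × ℝ → ℝ} (p u : ℝ × ℝ) (m : ℕ)
    (hf : ∀ r ∈ Set.Icc (0 : ℝ) 1, AnalyticAt ℝ f (p + r • u))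
    (h0 : ∀ j < m, iteratedFDeriv ℝ j f p = 0) (h1 : f (p + u) = 0) :
    ∃ r ∈ Set.Ioc (0 : ℝ) 1, iteratedFDeriv ℝ m f (p + r • u) (fun _ => u) = 0 := by
  induction m with
  | zero => exact ⟨1, by simp, by simpa using h1⟩
  | succ m ih =>
    obtain ⟨r, hr, hr0⟩ := ih (fun j hj => h0 j (by omega))
    have hd : ∀ x ∈ Set.Icc (0 : ℝ) r, HasDerivAt
        (fun r : ℝ => iteratedFDeriv ℝ m f (p + r • u) (fun _ => u))
        (iteratedFDeriv ℝ (m + 1) f (p + x • u) (fun _ => u)) x :=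
      fun x hx => hasDerivAt_diag p u m x (hf x ⟨hx.1, hx.2.trans hr.2⟩)
    obtain ⟨c, hc, hc0⟩ := exists_hasDerivAt_eq_zero hr.1
      (fun x hx => (hd x hx).continuousAt.continuousWithinAt)
      (by simp only [hr0]; simp [h0 m (by omega)])
      (fun x hx => hd x ⟨hx.1.le, hx.2.le⟩)
    exact ⟨c, ⟨hc.1, hc.2.le.trans hr.2⟩, hc0⟩

/-- Coordinates along a direction `v` transverse to `g = 0`. -/
lemma exists_chart {g : ℝ × ℝ → ℝ} {x0 v : ℝ × ℝ} (hg : AnalyticAt ℝ g x0) (hg0 : g x0 = 0)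
    (hv : fderiv ℝ g x0 v ≠ 0) :
    ∃ γ : ℝ → ℝ × ℝ, AnalyticAt ℝ γ 0 ∧ γ 0 = x0 ∧
      (∀ᶠ t in 𝓝 (0 : ℝ), g (γ t) = 0 ∧
        v.1 * (γ t - x0).2 - v.2 * (γ t - x0).1 = t) ∧
      ∀ᶠ x in 𝓝 x0, g x = 0 → x = γ (v.1 * (x - x0).2 - v.2 * (x - x0).1) := by
  let ℓ : ℝ × ℝ →L[ℝ] ℝ :=
    v.1 • ContinuousLinearMap.snd ℝ ℝ ℝ - v.2 • ContinuousLinearMap.fst ℝ ℝ ℝ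
  let L : ℝ × ℝ →L[ℝ] ℝ × ℝ := ℓ.prod (fderiv ℝ g x0)
  have hv0 : v ≠ 0 := by rintro rfl; simp at hv
  have hinj : Function.Injective L.toLinearMap := by
    rw [← LinearMap.ker_eq_bot, LinearMap.ker_eq_bot']
    intro x hx
    have hx1 : v.1 * x.2 - v.2 * x.1 = 0 := congrArg Prod.fst hx
    have hx2 : fderiv ℝ g x0 x = 0 := congrArg Prod.snd hx
    have h3 : x.1 • v = v.1 • x := by
      ext <;> simp <;> linarith
    have h4 : x.2 • v = v.2 • x := by
      ext <;> simp <;> linarith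
    have h3' := congrArg (fderiv ℝ g x0) h3
    have h4' := congrArg (fderiv ℝ g x0) h4
    simp only [map_smul, hx2, smul_eq_mul, mul_zero, mul_eq_zero, hv, or_false] at h3' h4'
    exact Prod.ext h3' h4'
  let i : (ℝ × ℝ) ≃L[ℝ] ℝ × ℝ :=
    (LinearEquiv.ofInjectiveEndo L.toLinearMap hinj).toContinuousLinearEquiv
  have hi : (i : ℝ × ℝ →L[ℝ] ℝ × ℝ) = L := by ext <;> rfl
  let Ψ : ℝ × ℝ → ℝ × ℝ := fun x => (ℓ (x - x0), g x)
  have hΨa : AnalyticAt ℝ Ψ x0 :=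
    ((ℓ.analyticAt _).comp (analyticAt_id.sub analyticAt_const)).prod hg
  have hΨd : HasFDerivAt Ψ L x0 := by
    have h1 : HasFDerivAt (fun x => ℓ (x - x0)) ℓ x0 := by
      have h8 : HasFDerivAt (fun x => ℓ x - ℓ x0) ℓ x0 := (ℓ.hasFDerivAt).sub_const _
      simpa only [map_sub] using h8
    exact h1.prodMk hg.differentiableAt.hasFDerivAt
  have hΨs : HasStrictFDerivAt Ψ (i : ℝ × ℝ →L[ℝ] ℝ × ℝ) x0 := by
    rw [hi, ← hΨd.fderiv]
    exact hΨa.hasStrictFDerivAt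
  have hΨ0 : Ψ x0 = (0, 0) := by simp [Ψ, hg0]
  let R := hΨs.toOpenPartialHomeomorph Ψ
  have hR0 : x0 ∈ R.source := hΨs.mem_toOpenPartialHomeomorph_source
  have hRs : AnalyticAt ℝ R.symm (Ψ x0) :=
    R.analyticAt_symm' (i := i) hR0 hΨa (hΨd.fderiv.trans hi.symm)
  have hRx : R.symm (Ψ x0) = x0 := R.left_inv hR0
  rw [hΨ0] at hRs hRx
  have hpair : AnalyticAt ℝ (fun t : ℝ => (t, (0 : ℝ))) 0 := analyticAt_id.prod analyticAt_const
  refine ⟨fun t => R.symm (t, 0), ?_, hRx, ?_, ?_⟩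
  · exact AnalyticAt.comp (g := R.symm) (f := fun t : ℝ => (t, (0 : ℝ))) hRs hpair
  · have hmem : R.target ∈ 𝓝 ((0 : ℝ), (0 : ℝ)) := by
      rw [← hΨ0]
      exact R.open_target.mem_nhds (R.map_source hR0)
    have : ∀ᶠ t in 𝓝 (0 : ℝ), ((t, 0) : ℝ × ℝ) ∈ R.target :=
      hpair.continuousAt.eventually hmem
    filter_upwards [this] with t ht
    have h5 : Ψ (R.symm (t, 0)) = (t, 0) := R.right_inv ht
    exact ⟨congrArg Prod.snd h5, congrArg Prod.fst h5⟩
  · filter_upwards [R.open_source.mem_nhds hR0] with x hx hgx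
    have h6 : R.symm (Ψ x) = x := R.left_inv hx
    have h7 : Ψ x = (v.1 * (x - x0).2 - v.2 * (x - x0).1, 0) := by
      rw [← hgx]; rfl
    rw [h7] at h6
    exact h6.symm

theorem stmt4 (U : Set (ℝ × ℝ)) (hU : IsOpen U) (x0 : ℝ × ℝ) (hx0 : x0 ∈ U)
    (f : ℝ × ℝ → ℝ) (hf : AnalyticOnNhd ℝ f U) (hfx0 : f x0 = 0)
    (m : ℕ) (hm : 1 ≤ m)
    (Γ₁ : ℝ → ℝ × ℝ) (hΓ₁ : AnalyticOnNhd ℝ Γ₁ (Set.Icc 0 1))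
    (hΓ₁nc : ¬ ∀ t ∈ Set.Icc (0 : ℝ) 1, Γ₁ t = x0)
    (hΓ₁0 : Γ₁ 0 = x0) (hΓ₁U : ∀ t ∈ Set.Icc (0 : ℝ) 1, Γ₁ t ∈ U)
    (hdeg : ∀ t ∈ Set.Icc (0 : ℝ) 1, degVan f (Γ₁ t) = m) :
    ∃ V ∈ nhds x0, ∃ γ : ℝ → ℝ × ℝ, ∃ ε > (0 : ℝ),
      AnalyticOnNhd ℝ γ (Set.Ioo (-ε) ε) ∧
      Set.InjOn γ (Set.Ioo (-ε) ε) ∧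
      γ 0 = x0 ∧
      {x ∈ V | f x = 0} = γ '' Set.Ioo (-ε) ε ∧
      ∀ x ∈ γ '' Set.Ioo (-ε) ε, degVan f x = m := by
  have h00 : (0 : ℝ) ∈ Set.Icc (0 : ℝ) 1 := by simp
  -- all derivatives of order `< m` vanish at `x0`
  have hlow0 : ∀ j < m, iteratedFDeriv ℝ j f x0 = 0 := by
    intro j hj
    rcases Nat.eq_zero_or_pos j with rfl | hj1
    · ext w; simpa using hfx0
    · have := (degVan_spec hm (hdeg 0 h00)).2 j hj1 hj
      rwa [hΓ₁0] at this
  have htop0 : iteratedFDeriv ℝ m f x0 ≠ 0 := by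
    have := (degVan_spec hm (hdeg 0 h00)).1
    rwa [hΓ₁0] at this
  obtain ⟨v, hv⟩ := exists_diag_ne (hf x0 hx0) htop0
  obtain ⟨n, rfl⟩ : ∃ n, m = n + 1 := ⟨m - 1, by omega⟩
  have hDa : ∀ j, AnalyticOnNhd ℝ (iteratedFDeriv ℝ j f) U := fun j => hf.iteratedFDeriv j
  let ev : ∀ j : ℕ, ((ℝ × ℝ) [×j]→L[ℝ] ℝ) →L[ℝ] ℝ :=
    fun j => ContinuousMultilinearMap.apply ℝ (fun _ : Fin j => ℝ × ℝ) ℝ (fun _ => v)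
  have hga : ∀ j, AnalyticOnNhd ℝ (fun x => iteratedFDeriv ℝ j f x (fun _ => v)) U :=
    fun j x hx => ((ev j).analyticAt _).comp (hDa j x hx)
  have hgv : fderiv ℝ (fun x => iteratedFDeriv ℝ n f x (fun _ => v)) x0 v ≠ 0 := by
    have := (hDa n x0 hx0).differentiableAt.iteratedFDeriv_succ_apply_left' (m := fun _ => v)
    rw [this] at hv
    exact hv
  obtain ⟨γ, hγa, hγ0, hγ1, hγ2⟩ :=
    exists_chart (hga n x0 hx0) (by simp [hlow0 n (by omega)]) hgv
  have hγU : ∀ᶠ t in 𝓝 (0 : ℝ), γ t ∈ U := by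
    apply hγa.continuousAt.eventually
    rw [hγ0]; exact hU.mem_nhds hx0
  -- the derivatives of order `< m` vanish along `γ`
  have hlow : ∀ j < n + 1, ∀ᶠ t in 𝓝 (0 : ℝ), iteratedFDeriv ℝ j f (γ t) = 0 := by
    intro j hj
    rcases Nat.eq_zero_or_pos n with rfl | hn
    · obtain rfl : j = 0 := by omega
      filter_upwards [hγ1] with t ht
      ext w
      simpa using ht.1
    · have hlowΓ : ∀ t ∈ Set.Icc (0 : ℝ) 1, ∀ j < n + 1, iteratedFDeriv ℝ j f (Γ₁ t) = 0 := by
        intro t ht j hj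
        rcases Nat.eq_zero_or_pos j with rfl | hj1
        · have hd : ∀ s ∈ Set.Icc (0 : ℝ) 1, HasDerivAt (fun s => f (Γ₁ s)) 0 s := by
            intro s hs
            have h1 := (degVan_spec hm (hdeg s hs)).2 1 le_rfl (by omega)
            have h2 : fderiv ℝ f (Γ₁ s) = 0 := by
              rw [← norm_eq_zero, ← norm_iteratedFDeriv_one, h1, norm_zero]
            have h3 := (hf _ (hΓ₁U s hs)).differentiableAt.hasFDerivAt
            rw [h2] at h3
            have := h3.comp_hasDerivAt s (hΓ₁ s hs).differentiableAt.hasDerivAt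
            simpa using! this
          have := constant_of_has_deriv_right_zero
            (fun s hs => (hd s hs).continuousAt.continuousWithinAt)
            (fun s hs => (hd s ⟨hs.1, hs.2.le⟩).hasDerivWithinAt) t ht
          ext w
          simpa [hΓ₁0, hfx0] using this
        · exact (degVan_spec hm (hdeg t ht)).2 j hj1 hj
      have hcomp : AnalyticAt ℝ (fun t => iteratedFDeriv ℝ j f (γ t)) 0 := by
        apply AnalyticAt.comp (g := iteratedFDeriv ℝ j f) (f := γ) _ hγa
        rw [hγ0]; exact hDa j x0 hx0
      rw [← hcomp.frequently_zero_iff_eventually_zero]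
      have hΓc : Tendsto Γ₁ (𝓝[>] 0) (𝓝 x0) := by
        have := (hΓ₁ 0 h00).continuousAt.tendsto
        rw [hΓ₁0] at this
        exact this.mono_left nhdsWithin_le_nhds
      have hne : ∀ᶠ s in 𝓝[>] (0 : ℝ), Γ₁ s ≠ x0 := by
        rcases (hΓ₁ 0 h00).eventually_eq_or_eventually_ne
          (analyticAt_const (v := x0)) with h | h
        · exfalso
          apply hΓ₁nc
          have := hΓ₁.eqOn_of_preconnected_of_eventuallyEq
            (g := fun _ => x0) analyticOnNhd_const isPreconnected_Icc h00 h
          exact this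
        · exact h.filter_mono (nhdsWithin_mono _ fun s hs => ne_of_gt hs)
      have hIcc : ∀ᶠ s in 𝓝[>] (0 : ℝ), s ∈ Set.Icc (0 : ℝ) 1 :=
        Icc_mem_nhdsGT one_pos
      have hlin : Tendsto (fun s => v.1 * (Γ₁ s - x0).2 - v.2 * (Γ₁ s - x0).1)
          (𝓝[>] 0) (𝓝 0) := by
        have hc : Continuous (fun x : ℝ × ℝ => v.1 * (x - x0).2 - v.2 * (x - x0).1) := by
          fun_prop
        have := (hc.tendsto x0).comp hΓc
        simpa using! this
      have hev : ∀ᶠ s in 𝓝[>] (0 : ℝ),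
          Γ₁ s = γ (v.1 * (Γ₁ s - x0).2 - v.2 * (Γ₁ s - x0).1) := by
        filter_upwards [hΓc.eventually hγ2, hIcc] with s hs hs1
        exact hs (by simp [hlowΓ s hs1 n (by omega)])
      have hlin' : Tendsto (fun s => v.1 * (Γ₁ s - x0).2 - v.2 * (Γ₁ s - x0).1)
          (𝓝[>] 0) (𝓝[≠] 0) := by
        refine tendsto_nhdsWithin_iff.2 ⟨hlin, ?_⟩
        filter_upwards [hev, hne] with s hs hs1 hs2
        rw [Set.mem_singleton_iff] at hs2
        rw [hs2, hγ0] at hs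
        exact hs1 hs
      refine hlin'.frequently (Eventually.frequently ?_)
      filter_upwards [hev, hIcc] with s hs hs1
      rw [← hs]
      exact hlowΓ s hs1 j hj
  have hlow' : ∀ᶠ t in 𝓝 (0 : ℝ), ∀ j < n + 1, iteratedFDeriv ℝ j f (γ t) = 0 := by
    have := (Filter.eventually_all_finset (l := 𝓝 (0 : ℝ)) (Finset.range (n + 1))
      (p := fun j t => iteratedFDeriv ℝ j f (γ t) = 0)).2
      (fun j hj => hlow j (Finset.mem_range.1 hj))
    filter_upwards [this] with t ht j hj using ht j (Finset.mem_range.2 hj)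
  -- choose a ball
  have hB : ∀ᶠ x in 𝓝 x0, x ∈ U ∧ iteratedFDeriv ℝ (n + 1) f x (fun _ => v) ≠ 0 :=
    (hU.eventually_mem hx0).and ((hga (n + 1) x0 hx0).continuousAt.eventually_ne hv)
  obtain ⟨ρ, hρ, hball⟩ := Metric.eventually_nhds_iff_ball.1 hB
  have hγB : ∀ᶠ t in 𝓝 (0 : ℝ), γ t ∈ Metric.ball x0 ρ := by
    apply hγa.continuousAt.eventually
    rw [hγ0]; exact Metric.ball_mem_nhds _ hρ
  obtain ⟨ε, hε, hall⟩ := Metric.eventually_nhds_iff_ball.1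
    ((hγB.and hlow').and (hγ1.and hγa.eventually_analyticAt))
  rw [Real.ball_eq_Ioo, zero_sub, zero_add] at hall
  let ℓ : ℝ × ℝ → ℝ := fun x => v.1 * (x - x0).2 - v.2 * (x - x0).1
  have hℓc : Continuous ℓ := by fun_prop
  have hv0 : v ≠ 0 := by rintro rfl; simp at hgv
  have hzero : ∀ t ∈ Set.Ioo (-ε) ε, f (γ t) = 0 := by
    intro t ht
    have := (hall t ht).1.2 0 (by omega)
    have := congrArg (fun M => M 0) this
    simpa using this
  refine ⟨Metric.ball x0 ρ ∩ ℓ ⁻¹' Set.Ioo (-ε) ε, ?_, γ, ε, hε, ?_, ?_, hγ0, ?_, ?_⟩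
  · refine inter_mem (Metric.ball_mem_nhds _ hρ) (hℓc.continuousAt.preimage_mem_nhds ?_)
    have : ℓ x0 = 0 := by simp [ℓ]
    rw [this]
    exact Ioo_mem_nhds (by linarith) hε
  · exact fun t ht => (hall t ht).2.2
  · intro s hs t ht hst
    rw [← (hall s hs).2.1.2, ← (hall t ht).2.1.2, hst]
  · ext x
    constructor
    · rintro ⟨⟨hxB, hxℓ⟩, hfx⟩
      refine ⟨ℓ x, hxℓ, ?_⟩
      by_contra hne
      set p := γ (ℓ x) with hp
      have hpB : p ∈ Metric.ball x0 ρ := (hall _ hxℓ).1.1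
      have hpℓ : v.1 * (p - x0).2 - v.2 * (p - x0).1 =
        v.1 * (x - x0).2 - v.2 * (x - x0).1 := (hall _ hxℓ).2.1.2
      obtain ⟨s, hs⟩ : ∃ s : ℝ, x - p = s • v := by
        simp only [Prod.snd_sub, Prod.fst_sub] at hpℓ
        by_cases h1 : v.1 = 0
        · have h2 : v.2 ≠ 0 := fun h2 => hv0 (Prod.ext h1 h2)
          refine ⟨(x.2 - p.2) / v.2, Prod.ext ?_ ?_⟩
          · simp only [h1, Prod.fst_sub, Prod.smul_fst, smul_eq_mul, mul_zero]
            rw [h1] at hpℓ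
            apply mul_left_cancel₀ h2
            linarith
          · simp [h2]
        · refine ⟨(x.1 - p.1) / v.1, Prod.ext ?_ ?_⟩
          · simp [h1]
          · simp only [Prod.snd_sub, Prod.smul_snd, smul_eq_mul]
            field_simp
            linarith
      have hs0 : s ≠ 0 := by
        rintro rfl
        rw [zero_smul, sub_eq_zero] at hs
        exact hne hs.symm
      have hseg : ∀ r ∈ Set.Icc (0 : ℝ) 1, p + r • (x - p) ∈ Metric.ball x0 ρ :=
        fun r hr => (convex_ball x0 ρ).add_smul_sub_mem hpB hxB hr
      obtain ⟨r, hr, hr0⟩ := rolle_diag p (x - p) (n + 1)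
        (fun r hr => hf _ (hball _ (hseg r hr)).1) (hall _ hxℓ).1.2 (by simpa using hfx)
      have h9 := (hball _ (hseg r ⟨hr.1.le, hr.2⟩)).2
      have h10 : iteratedFDeriv ℝ (n + 1) f (p + r • (x - p)) (fun _ => x - p) =
          s ^ (n + 1) * iteratedFDeriv ℝ (n + 1) f (p + r • (x - p)) (fun _ => v) := by
        have := (iteratedFDeriv ℝ (n + 1) f (p + r • (x - p))).map_smul_univ
          (fun _ => s) (fun _ => v)
        rw [← hs] at this
        simpa using this
      rw [h10] at hr0
      exact mul_ne_zero (pow_ne_zero _ hs0) h9 hr0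
    · rintro ⟨t, ht, rfl⟩
      refine ⟨⟨(hall t ht).1.1, ?_⟩, hzero t ht⟩
      have : ℓ (γ t) = t := (hall t ht).2.1.2
      rw [Set.mem_preimage, this]
      exact ht
  · rintro _ ⟨t, ht, rfl⟩
    refine degVan_eq hm ?_ (hall t ht).1.2
    intro h
    apply (hball _ (hall t ht).1.1).2
    rw [h]; rfl
end
end

section
/- Let ψ be real-analytic on a neighborhood of the closure of a bounded domain Ω_Γ ⊂ ℝ², satisfying Δψ = F(ψ) in Ω_Γ for a continuous function F, with ψ = 0 and ∇ψ = 0 on ∂Ω_Γ. Suppose every point of ∂Ω_Γ has degree of vanishing d_ψ ≥ 3 and the critical zeros of ψ in Ω_Γ ∩ {ψ = 0} are isolated. If ψ takes both positive and negative values in Ω_Γ, then F is real-analytic in a neighborhood of 0 with F(0) = 0, and this contradicts the degree drop d_{Δψ} = d_ψ − 2 ≥ 1 on ∂Ω_Γ; hence ψ is single-signed in Ω_Γ. -/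
noncomputable section

/-- The Laplacian on `ℝ²`. -/
def lap (f : ℝ × ℝ → ℝ) (x : ℝ × ℝ) : ℝ :=
  iteratedFDeriv ℝ 2 f x ![(1, 0), (1, 0)] + iteratedFDeriv ℝ 2 f x ![(0, 1), (0, 1)]

open Filter Topology

/-- Vanishing to order `n` at `p`. -/
def VanO {E : Type} [NormedAddCommGroup E] [NormedSpace ℝ E] (n : ℕ) (f : ℝ × ℝ → E)
    (p : ℝ × ℝ) : Prop := ∀ k < n, iteratedFDeriv ℝ k f p = 0

def px (f : ℝ × ℝ → ℂ) (y : ℝ × ℝ) : ℂ := fderiv ℝ f y (1, 0)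
def py (f : ℝ × ℝ → ℂ) (y : ℝ × ℝ) : ℂ := fderiv ℝ f y (0, 1)

lemma VanO.mono {E : Type} [NormedAddCommGroup E] [NormedSpace ℝ E] {n m : ℕ} {f : ℝ × ℝ → E}
    {p : ℝ × ℝ} (h : VanO n f p) (hmn : m ≤ n) : VanO m f p := fun k hk => h k (by omega)

lemma VanO.congr {E : Type} [NormedAddCommGroup E] [NormedSpace ℝ E] {n : ℕ} {f g : ℝ × ℝ → E}
    {p : ℝ × ℝ} (h : VanO n f p) (hfg : f =ᶠ[𝓝 p] g) : VanO n g p := fun k hk => by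
  rw [← (Filter.EventuallyEq.iteratedFDeriv ℝ hfg k).eq_of_nhds]; exact h k hk

lemma VanO.clm {E F : Type} [NormedAddCommGroup E] [NormedSpace ℝ E] [CompleteSpace E] [NormedAddCommGroup F]
    [NormedSpace ℝ F] {n : ℕ} {f : ℝ × ℝ → E} {p : ℝ × ℝ} (h : VanO n f p)
    (hf : AnalyticAt ℝ f p) (L : E →L[ℝ] F) : VanO n (fun y => L (f y)) p := fun k hk => by
  have := L.iteratedFDeriv_comp_left (n := ⊤) (i := k) hf.contDiffAt (by simp)
  have h2 : (fun y => L (f y)) = L ∘ f := rfl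
  rw [h2, this, h k hk]
  ext; simp

lemma VanO.add {E : Type} [NormedAddCommGroup E] [NormedSpace ℝ E] [CompleteSpace E] {n : ℕ} {f g : ℝ × ℝ → E}
    {p : ℝ × ℝ} (h : VanO n f p) (h' : VanO n g p) (hf : AnalyticAt ℝ f p)
    (hg : AnalyticAt ℝ g p) : VanO n (fun y => f y + g y) p := fun k hk => by
  have : (fun y => f y + g y) = f + g := rfl
  rw [this, iteratedFDeriv_add_apply hf.contDiffAt hg.contDiffAt, h k hk, h' k hk, add_zero]

lemma VanO.mul_left {n : ℕ} {f g : ℝ × ℝ → ℂ}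
    {p : ℝ × ℝ} (h : VanO n f p) (hf : AnalyticAt ℝ f p)
    (hg : AnalyticAt ℝ g p) : VanO n (fun y => f y * g y) p := fun k hk => by
  set s := {y | AnalyticAt ℝ f y} ∩ {y | AnalyticAt ℝ g y} with hs
  have hso : IsOpen s := (isOpen_analyticAt ℝ f).inter (isOpen_analyticAt ℝ g)
  have hp : p ∈ s := ⟨hf, hg⟩
  have h1 : ContDiffOn ℝ ⊤ f s := fun y hy => (AnalyticAt.contDiffAt hy.1).contDiffWithinAt
  have h2 : ContDiffOn ℝ ⊤ g s := fun y hy => (AnalyticAt.contDiffAt hy.2).contDiffWithinAt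
  have := norm_iteratedFDerivWithin_mul_le (n := k) h1 h2 hso.uniqueDiffOn hp (by simp)
  rw [iteratedFDerivWithin_of_isOpen k hso hp] at this
  rw [← norm_le_zero_iff]
  refine this.trans (le_of_eq (Finset.sum_eq_zero fun i hi => ?_))
  rw [iteratedFDerivWithin_of_isOpen i hso hp, h i (by simp at hi; omega)]
  simp

lemma vanO_succ_iff_fderiv {E : Type} [NormedAddCommGroup E] [NormedSpace ℝ E] {n : ℕ}
    {f : ℝ × ℝ → E} {p : ℝ × ℝ} :
    VanO (n+1) f p ↔ f p = 0 ∧ VanO n (fderiv ℝ f) p := by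
  constructor
  · intro h
    refine ⟨?_, fun k hk => ?_⟩
    · have := h 0 (by omega)
      rw [← norm_eq_zero, norm_iteratedFDeriv_zero, norm_eq_zero] at this
      exact this
    · rw [← norm_eq_zero, norm_iteratedFDeriv_fderiv, h (k+1) (by omega), norm_zero]
  · rintro ⟨h0, h⟩ k hk
    rw [← norm_eq_zero]
    cases k with
    | zero => rw [norm_iteratedFDeriv_zero, h0, norm_zero]
    | succ k => rw [← norm_iteratedFDeriv_fderiv, h k (by omega), norm_zero]

lemma an_px {f : ℝ × ℝ → ℂ} {p : ℝ × ℝ} (hf : AnalyticAt ℝ f p) : AnalyticAt ℝ (px f) p :=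
  ((ContinuousLinearMap.apply ℝ ℂ ((1, 0) : ℝ × ℝ)).analyticAt _).comp hf.fderiv
lemma an_py {f : ℝ × ℝ → ℂ} {p : ℝ × ℝ} (hf : AnalyticAt ℝ f p) : AnalyticAt ℝ (py f) p :=
  ((ContinuousLinearMap.apply ℝ ℂ ((0, 1) : ℝ × ℝ)).analyticAt _).comp hf.fderiv

lemma vanO_succ_iff {n : ℕ} {f : ℝ × ℝ → ℂ} {p : ℝ × ℝ} (hf : AnalyticAt ℝ f p) :
    VanO (n+1) f p ↔ f p = 0 ∧ VanO n (px f) p ∧ VanO n (py f) p := by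
  rw [vanO_succ_iff_fderiv]
  refine and_congr_right fun _ => ⟨fun h => ⟨?_, ?_⟩, fun h => ?_⟩
  · exact h.clm hf.fderiv (ContinuousLinearMap.apply ℝ ℂ ((1, 0) : ℝ × ℝ))
  · exact h.clm hf.fderiv (ContinuousLinearMap.apply ℝ ℂ ((0, 1) : ℝ × ℝ))
  · let L1 := ContinuousLinearMap.smulRightL ℝ (ℝ × ℝ) ℂ (ContinuousLinearMap.fst ℝ ℝ ℝ)
    let L2 := ContinuousLinearMap.smulRightL ℝ (ℝ × ℝ) ℂ (ContinuousLinearMap.snd ℝ ℝ ℝ)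
    have h1 := h.1.clm (an_px hf) L1
    have h2 := h.2.clm (an_py hf) L2
    have := h1.add h2 ((L1.analyticAt _).comp (an_px hf)) ((L2.analyticAt _).comp (an_py hf))
    convert this using 1
    funext y
    ext <;> simp [L1, L2, px, py]

lemma VanO.isBigO {n : ℕ} {f : ℝ × ℝ → ℂ} {p : ℝ × ℝ} (hf : AnalyticAt ℝ f p) (h : VanO n f p) :
    ∃ C, ∀ᶠ y in 𝓝 p, ‖f y‖ ≤ C * ‖y - p‖ ^ n := by
  obtain ⟨P, r, hP⟩ := hf
  have h1 := (HasFPowerSeriesOnBall.hasFPowerSeriesAt hP).isBigO_sub_partialSum_pow n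
  have h0 : ∀ y, P.partialSum n y = 0 := by
    intro y
    refine Finset.sum_eq_zero fun k hk => ?_
    have := hP.factorial_smul y k
    rw [h k (by simpa using hk)] at this
    simpa [Nat.factorial_ne_zero] using this
  simp only [h0, sub_zero] at h1
  obtain ⟨C, hC⟩ := h1.bound
  refine ⟨C, ?_⟩
  have ht : Tendsto (fun y => y - p) (𝓝 p) (𝓝 0) := by
    have : Tendsto (fun y => y - p) (𝓝 p) (𝓝 (p - p)) := tendsto_id.sub_const p
    simpa using this
  filter_upwards [ht.eventually hC] with y hy
  simpa using hy


def zL : ℝ × ℝ →L[ℝ] ℂ := Complex.ofRealCLM.comp (ContinuousLinearMap.fst ℝ ℝ ℝ) +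
      Complex.I • (Complex.ofRealCLM.comp (ContinuousLinearMap.snd ℝ ℝ ℝ))

lemma zL_apply (v : ℝ × ℝ) : zL v = v.1 + Complex.I * v.2 := by simp [zL]

lemma norm_le_zL (v : ℝ × ℝ) : ‖v‖ ≤ ‖zL v‖ := by
  rw [Prod.norm_def]
  refine max_le ?_ ?_
  · have := Complex.abs_re_le_norm (zL v)
    simpa [zL_apply] using this
  · have := Complex.abs_im_le_norm (zL v)
    simpa [zL_apply] using this

lemma an_zp (c : ℂ) (n : ℕ) (p q : ℝ × ℝ) : AnalyticAt ℝ (fun y => c * zL (y - p) ^ n) q := by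
  have h : AnalyticAt ℝ (fun y => zL (y - p)) q :=
    (zL.analyticAt _).comp (analyticAt_id.sub analyticAt_const)
  exact analyticAt_const.mul (h.pow n)

lemma fd_zp (c : ℂ) (n : ℕ) (p y v : ℝ × ℝ) :
    fderiv ℝ (fun y => c / (n + 1 : ℂ) * zL (y - p) ^ (n + 1)) y v
      = c * zL (y - p) ^ n * zL v := by
  have h1 : HasFDerivAt (fun y => zL (y - p)) zL y := by
    exact zL.hasFDerivAt.comp y ((hasFDerivAt_id y).sub_const p)
  have h2 := ((h1.pow (n + 1)).const_mul (c / (n + 1 : ℂ)))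
  have hn : (n + 1 : ℂ) ≠ 0 := by exact_mod_cast Nat.succ_ne_zero n
  rw [h2.fderiv]
  simp
  field_simp

lemma fd_sub {f g : ℝ × ℝ → ℂ} {y : ℝ × ℝ} (v : ℝ × ℝ) (hf : AnalyticAt ℝ f y)
    (hg : AnalyticAt ℝ g y) :
    fderiv ℝ (fun y => f y - g y) y v = fderiv ℝ f y v - fderiv ℝ g y v := by
  rw [fderiv_fun_sub hf.differentiableAt hg.differentiableAt]; simp

lemma VanO.const_mul {n : ℕ} {f : ℝ × ℝ → ℂ} {p : ℝ × ℝ} (h : VanO n f p)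
    (hf : AnalyticAt ℝ f p) (c : ℂ) : VanO n (fun y => c * f y) p := by
  have := h.mul_left hf (analyticAt_const (v := c))
  simpa [mul_comm] using this

lemma fd_comm {f : ℝ × ℝ → ℂ} {y : ℝ × ℝ} (hf : AnalyticAt ℝ f y) :
    px (py f) y = py (px f) y := by
  have hs : IsSymmSndFDerivAt ℝ f y := (hf.contDiffAt (n := 2)).isSymmSndFDerivAt (by simp)
  have hd : DifferentiableAt ℝ (fderiv ℝ f) y := hf.fderiv.differentiableAt
  have key : ∀ v w : ℝ × ℝ, fderiv ℝ (fun z => fderiv ℝ f z v) y w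
      = fderiv ℝ (fderiv ℝ f) y w v := by
    intro v w
    rw [fderiv_clm_apply hd (differentiableAt_const v)]
    simp
  change fderiv ℝ (fun z => fderiv ℝ f z _) y _ = fderiv ℝ (fun z => fderiv ℝ f z _) y _
  rw [key, key]
  exact hs _ _

/-- Leading term of an approximately holomorphic function. -/
lemma leading (p : ℝ × ℝ) : ∀ (n : ℕ) (h : ℝ × ℝ → ℂ), AnalyticAt ℝ h p → VanO n h p →
    VanO n (fun y => py h y - Complex.I * px h y) p →
    ∃ c : ℂ, VanO (n + 1) (fun y => h y - c * zL (y - p) ^ n) p := by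
  intro n
  induction n with
  | zero =>
    intro h hh _ _
    refine ⟨h p, ?_⟩
    rw [vanO_succ_iff (hh.fun_sub (an_zp _ _ _ _))]
    refine ⟨by simp, fun k hk => by omega, fun k hk => by omega⟩
  | succ n ih =>
    intro h hh hV hL
    have hLan : AnalyticAt ℝ (fun y => py h y - Complex.I * px h y) p :=
      (an_py hh).sub (analyticAt_const.mul (an_px hh))
    have hV' := (vanO_succ_iff hh).1 hV
    have hL' := ((vanO_succ_iff hLan).1 hL).2.1
    have hev : px (fun y => py h y - Complex.I * px h y) =ᶠ[𝓝 p]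
        fun y => py (px h) y - Complex.I * px (px h) y := by
      filter_upwards [hh.eventually_analyticAt] with y hy
      have h1 := an_px hy
      have h2 := an_py hy
      rw [← fd_comm hy]
      unfold px
      have h3 : AnalyticAt ℝ (fun y => Complex.I * px h y) y := analyticAt_const.mul h1
      have := fd_sub (1, 0) h2 h3
      unfold px at this
      rw [this, fderiv_const_mul]
      · simp
      · exact h1.differentiableAt
    obtain ⟨c, hc⟩ := ih (px h) (an_px hh) hV'.2.1 (hL'.congr hev)
    refine ⟨c / (n + 1 : ℂ), ?_⟩
    rw [vanO_succ_iff (hh.fun_sub (an_zp _ _ _ _))]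
    have hcan : AnalyticAt ℝ (fun y => px h y - c * zL (y - p) ^ n) p :=
      (an_px hh).sub (an_zp _ _ _ _)
    refine ⟨by simp [hV'.1], ?_, ?_⟩
    · refine hc.congr ?_
      filter_upwards [hh.eventually_analyticAt] with y hy
      unfold px
      rw [fd_sub _ hy (an_zp _ _ _ _), fd_zp]
      simp [zL_apply]
    · refine (hL.add (hc.const_mul hcan Complex.I) hLan (analyticAt_const.mul hcan)).congr ?_
      filter_upwards [hh.eventually_analyticAt] with y hy
      unfold py px
      rw [fd_sub _ hy (an_zp _ _ _ _), fd_zp]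
      simp [zL_apply]
      ring

lemma vanO_ofReal {n : ℕ} {ψ : ℝ × ℝ → ℝ} {p : ℝ × ℝ} (hψ : AnalyticAt ℝ ψ p) :
    VanO n (fun y => (ψ y : ℂ)) p ↔ VanO n ψ p := by
  have key : ∀ k, ‖iteratedFDeriv ℝ k (fun y => (ψ y : ℂ)) p‖ = ‖iteratedFDeriv ℝ k ψ p‖ :=
    fun k => Complex.ofRealLI.norm_iteratedFDeriv_comp_left (n := ⊤) hψ.contDiffAt (by simp)
  constructor
  · intro h k hk
    rw [← norm_eq_zero, ← key, h k hk, norm_zero]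
  · intro h k hk
    rw [← norm_eq_zero, key, h k hk, norm_zero]

lemma an_ofReal {ψ : ℝ × ℝ → ℝ} {p : ℝ × ℝ} (hψ : AnalyticAt ℝ ψ p) :
    AnalyticAt ℝ (fun y => (ψ y : ℂ)) p :=
  (Complex.ofRealCLM.analyticAt _).comp hψ

lemma fd_ofReal {f : ℝ × ℝ → ℝ} {y : ℝ × ℝ} (v : ℝ × ℝ) (hf : AnalyticAt ℝ f y) :
    fderiv ℝ (fun y => (f y : ℂ)) y v = (fderiv ℝ f y v : ℂ) := by
  have : HasFDerivAt (fun y => (f y : ℂ)) (Complex.ofRealCLM.comp (fderiv ℝ f y)) y :=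
    Complex.ofRealCLM.hasFDerivAt.comp y hf.differentiableAt.hasFDerivAt
  rw [this.fderiv]; simp

lemma an_fd {f : ℝ × ℝ → ℝ} {p : ℝ × ℝ} (v : ℝ × ℝ) (hf : AnalyticAt ℝ f p) :
    AnalyticAt ℝ (fun y => fderiv ℝ f y v) p :=
  ((ContinuousLinearMap.apply ℝ ℝ v).analyticAt _).comp hf.fderiv

lemma lap_eq {f : ℝ × ℝ → ℝ} {y : ℝ × ℝ} (hf : AnalyticAt ℝ f y) :
    lap f y = fderiv ℝ (fun z => fderiv ℝ f z (1, 0)) y (1, 0)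
      + fderiv ℝ (fun z => fderiv ℝ f z (0, 1)) y (0, 1) := by
  have hd : DifferentiableAt ℝ (fderiv ℝ f) y := hf.fderiv.differentiableAt
  have key : ∀ v w : ℝ × ℝ, fderiv ℝ (fun z => fderiv ℝ f z v) y w
      = fderiv ℝ (fderiv ℝ f) y w v := by
    intro v w
    rw [fderiv_clm_apply hd (differentiableAt_const v)]
    simp
  rw [key, key, lap, iteratedFDeriv_two_apply, iteratedFDeriv_two_apply]
  simp

lemma an_lap {f : ℝ × ℝ → ℝ} {p : ℝ × ℝ} (hf : AnalyticAt ℝ f p) : AnalyticAt ℝ (lap f) p := by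
  refine ((an_fd (1, 0) (an_fd (1, 0) hf)).fun_add (an_fd (0, 1) (an_fd (0, 1) hf))).congr ?_
  filter_upwards [hf.eventually_analyticAt] with y hy
  rw [lap_eq hy]

lemma lap_cplx {f : ℝ × ℝ → ℝ} {y : ℝ × ℝ} (hf : AnalyticAt ℝ f y) :
    px (px fun z => (f z : ℂ)) y + py (py fun z => (f z : ℂ)) y = (lap f y : ℂ) := by
  have h1 : px (fun z => (f z : ℂ)) =ᶠ[𝓝 y] fun z => ((fderiv ℝ f z (1, 0) : ℝ) : ℂ) := by
    filter_upwards [hf.eventually_analyticAt] with z hz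
    exact fd_ofReal _ hz
  have h2 : py (fun z => (f z : ℂ)) =ᶠ[𝓝 y] fun z => ((fderiv ℝ f z (0, 1) : ℝ) : ℂ) := by
    filter_upwards [hf.eventually_analyticAt] with z hz
    exact fd_ofReal _ hz
  have e1 : px (px fun z => (f z : ℂ)) y
      = fderiv ℝ (fun z => ((fderiv ℝ f z (1, 0) : ℝ) : ℂ)) y (1, 0) := by
    rw [← h1.fderiv_eq]; rfl
  have e2 : py (py fun z => (f z : ℂ)) y
      = fderiv ℝ (fun z => ((fderiv ℝ f z (0, 1) : ℝ) : ℂ)) y (0, 1) := by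
    rw [← h2.fderiv_eq]; rfl
  rw [e1, e2, fd_ofReal _ (an_fd _ hf), fd_ofReal _ (an_fd _ hf), lap_eq hf]
  push_cast; rfl

lemma degVan_spec_s15 (ψ : ℝ × ℝ → ℝ) (p : ℝ × ℝ) (h0 : ψ p = 0)
    (hd : 3 ≤ degVan ψ p) : ∃ n, VanO (n + 1) ψ p ∧ ¬ VanO (n + 2) ψ p := by
  have hne : {k | 1 ≤ k ∧ iteratedFDeriv ℝ k ψ p ≠ 0}.Nonempty :=
    Nat.nonempty_of_pos_sInf (by unfold degVan at hd; omega)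
  have hm := Nat.sInf_mem hne
  change 1 ≤ degVan ψ p ∧ iteratedFDeriv ℝ (degVan ψ p) ψ p ≠ 0 at hm
  obtain ⟨n, hn⟩ : ∃ n, degVan ψ p = n + 1 := ⟨degVan ψ p - 1, by omega⟩
  refine ⟨n, fun k hk => ?_, fun h => hm.2 (h _ (by omega))⟩
  by_contra hc
  rcases Nat.eq_zero_or_pos k with rfl | hk0
  · apply hc
    rw [← norm_eq_zero, norm_iteratedFDeriv_zero, h0, norm_zero]
  · exact Nat.notMem_of_lt_sInf (m := k) (s := {k | 1 ≤ k ∧ iteratedFDeriv ℝ k ψ p ≠ 0})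
      (by unfold degVan at hn; omega) ⟨hk0, hc⟩

lemma isolated (ψ : ℝ × ℝ → ℝ) (p : ℝ × ℝ) (hψ : AnalyticAt ℝ ψ p) (H : ℝ × ℝ → ℝ)
    (hH : AnalyticAt ℝ H p) (heq : ∀ᶠ y in 𝓝 p, lap ψ y = ψ y * H y) (h0 : ψ p = 0)
    (hd : 3 ≤ degVan ψ p) : ∀ᶠ y in 𝓝 p, fderiv ℝ ψ y = 0 → y = p := by
  obtain ⟨n, hn1, hn2⟩ := degVan_spec_s15 ψ p h0 hd
  set Ψ : ℝ × ℝ → ℂ := fun y => (ψ y : ℂ) with hΨ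
  have hΨa : AnalyticAt ℝ Ψ p := an_ofReal hψ
  have hV : VanO (n + 1) Ψ p := (vanO_ofReal hψ).2 hn1
  have hV2 : ¬ VanO (n + 2) Ψ p := fun h => hn2 ((vanO_ofReal hψ).1 h)
  have hVp := (vanO_succ_iff hΨa).1 hV
  set φ : ℝ × ℝ → ℂ := fun y => px Ψ y + (-Complex.I) * py Ψ y with hφ
  have hφa : AnalyticAt ℝ φ p := (an_px hΨa).fun_add (analyticAt_const.fun_mul (an_py hΨa))
  have hφV : VanO n φ p := hVp.2.1.add (hVp.2.2.const_mul (an_py hΨa) _) (an_px hΨa)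
    (analyticAt_const.fun_mul (an_py hΨa))
  have hφL : VanO n (fun y => py φ y - Complex.I * px φ y) p := by
    have h1 := ((hV.mono (Nat.le_succ n)).mul_left hΨa (an_ofReal hH)).const_mul
      (hΨa.fun_mul (an_ofReal hH)) (-Complex.I)
    refine h1.congr ?_
    filter_upwards [hψ.eventually_analyticAt, heq] with y hy hye
    have hya : AnalyticAt ℝ Ψ y := an_ofReal hy
    have hl := lap_cplx hy
    rw [hye] at hl
    have key : ∀ v, fderiv ℝ φ y v = fderiv ℝ (px Ψ) y v + -Complex.I * fderiv ℝ (py Ψ) y v := by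
      intro v
      rw [hφ, fderiv_fun_add (an_px hya).differentiableAt
        ((an_py hya).differentiableAt.const_mul _), fderiv_const_mul (an_py hya).differentiableAt]
      simp
    have e1 : px φ y = px (px Ψ) y + -Complex.I * px (py Ψ) y := key _
    have e2 : py φ y = py (px Ψ) y + -Complex.I * py (py Ψ) y := key _
    rw [e1, e2, fd_comm hya]
    push_cast at hl
    rw [← hl]
    linear_combination (- py (px Ψ) y) * Complex.I_sq
  obtain ⟨c, hc⟩ := leading p n φ hφa hφV hφL
  have hre : ∀ᶠ y in 𝓝 p, px Ψ y = ((fderiv ℝ ψ y (1, 0) : ℝ) : ℂ) ∧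
      py Ψ y = ((fderiv ℝ ψ y (0, 1) : ℝ) : ℂ) := by
    filter_upwards [hψ.eventually_analyticAt] with y hy
    exact ⟨fd_ofReal _ hy, fd_ofReal _ hy⟩
  have hc0 : c ≠ 0 := by
    rintro rfl
    apply hV2
    simp only [zero_mul, sub_zero] at hc
    rw [vanO_succ_iff hΨa]
    refine ⟨hVp.1, ?_, ?_⟩
    · refine (hc.clm hφa (Complex.ofRealCLM.comp Complex.reCLM)).congr ?_
      filter_upwards [hre] with y hy
      simp [hφ, hy.1, hy.2]
    · refine (hc.clm hφa (-(Complex.ofRealCLM.comp Complex.imCLM))).congr ?_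
      filter_upwards [hre] with y hy
      simp [hφ, hy.1, hy.2]
  obtain ⟨C, hC⟩ := hc.isBigO (hφa.fun_sub (an_zp _ _ _ _))
  have hsm : ∀ᶠ y in 𝓝 p, C * ‖y - p‖ < ‖c‖ := by
    have : Tendsto (fun y => C * ‖y - p‖) (𝓝 p) (𝓝 (C * ‖p - p‖)) :=
      ((continuous_id.sub continuous_const).norm.const_mul C |>.tendsto p)
    refine this.eventually (gt_mem_nhds ?_)
    simpa using hc0
  filter_upwards [hre, hC, hsm] with y hy hyC hys hfd
  by_contra hne
  have hpos : 0 < ‖y - p‖ := norm_pos_iff.2 (sub_ne_zero.2 hne)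
  have hφ0 : φ y = 0 := by simp [hφ, hy.1, hy.2, hfd]
  rw [hφ0, zero_sub, norm_neg, norm_mul, norm_pow] at hyC
  have h3 : ‖y - p‖ ^ n ≤ ‖zL (y - p)‖ ^ n := pow_le_pow_left₀ hpos.le (norm_le_zL _) n
  have h4 : ‖c‖ * ‖y - p‖ ^ n ≤ C * ‖y - p‖ * ‖y - p‖ ^ n := by
    calc _ ≤ ‖c‖ * ‖zL (y - p)‖ ^ n := by gcongr
      _ ≤ _ := hyC
      _ = _ := by ring
  have := le_of_mul_le_mul_right h4 (pow_pos hpos n)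
  linarith

lemma rank2 : 1 < Module.rank ℝ (ℝ × ℝ) := Module.one_lt_rank_of_one_lt_finrank (by simp)

lemma punctured (p : ℝ × ℝ) (r : ℝ) : IsPreconnected (Metric.ball p r \ {p}) := by
  have h1 : IsPreconnected (Set.Ioo 0 r ×ˢ Metric.sphere (0 : ℝ × ℝ) 1) :=
    isPreconnected_Ioo.prod (isPreconnected_sphere rank2 0 1)
  have h2 := h1.image (fun q : ℝ × (ℝ × ℝ) => p + q.1 • q.2) (by fun_prop)
  convert h2 using 1
  ext y
  simp only [Set.mem_sdiff, Metric.mem_ball, Set.mem_singleton_iff, Set.mem_image, Set.mem_prod,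
    Set.mem_Ioo, mem_sphere_zero_iff_norm]
  constructor
  · rintro ⟨hy, hne⟩
    have hpos : 0 < ‖y - p‖ := norm_pos_iff.2 (sub_ne_zero.2 hne)
    refine ⟨(‖y - p‖, ‖y - p‖⁻¹ • (y - p)), ⟨⟨hpos, by rwa [← dist_eq_norm]⟩, ?_⟩, ?_⟩
    · simp only [norm_smul, norm_inv, norm_norm]
      field_simp
    · simp only [smul_smul]
      rw [mul_inv_cancel₀ hpos.ne']
      simp
  · rintro ⟨⟨t, u⟩, ⟨⟨ht, htr⟩, hu⟩, rfl⟩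
    simp only at ht htr hu ⊢
    refine ⟨?_, ?_⟩
    · simp [norm_smul, hu, abs_of_pos ht, htr]
    · intro h
      have h5 : t • u = 0 := by simpa using h
      rcases smul_eq_zero.1 h5 with h6 | h6
      · exact ht.ne' h6
      · simp [h6] at hu

lemma sign_of_no_regular (Ω : Set (ℝ × ℝ)) (hΩo : IsOpen Ω) (hΩc : IsPreconnected Ω)
    (ψ : ℝ × ℝ → ℝ) (hc : ContinuousOn ψ Ω)
    (hiso : ∀ x ∈ Ω, ψ x = 0 → ∃ V ∈ 𝓝 x, ∀ y ∈ V ∩ Ω, ψ y = 0 → y = x) :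
    (∀ x ∈ Ω, 0 ≤ ψ x) ∨ (∀ x ∈ Ω, ψ x ≤ 0) := by
  have hA : IsOpen {x | ∀ᶠ y in 𝓝 x, 0 ≤ ψ y} := isOpen_setOfPred_eventually_nhds
  have hB : IsOpen {x | ∀ᶠ y in 𝓝 x, ψ y ≤ 0} := isOpen_setOfPred_eventually_nhds
  have hca : ∀ x ∈ Ω, ContinuousAt ψ x := fun x hx => hc.continuousAt (hΩo.mem_nhds hx)
  have hcov : Ω ⊆ {x | ∀ᶠ y in 𝓝 x, 0 ≤ ψ y} ∪ {x | ∀ᶠ y in 𝓝 x, ψ y ≤ 0} := by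
    intro x hx
    rcases lt_trichotomy (ψ x) 0 with h | h | h
    · right
      exact ((hca x hx).eventually (gt_mem_nhds h)).mono fun y hy => le_of_lt hy
    · obtain ⟨V, hV, hVi⟩ := hiso x hx h
      obtain ⟨r, hr, hrV⟩ := Metric.mem_nhds_iff.1 (inter_mem hV (hΩo.mem_nhds hx))
      have hpc := (punctured x r).image ψ
        (hc.mono fun y hy => (hrV hy.1).2)
      have hnz : ∀ y ∈ Metric.ball x r, y ≠ x → ψ y ≠ 0 := fun y hy hne h0 =>
        hne (hVi y (hrV hy) h0)
      have hb : Metric.ball x r ∈ 𝓝 x := Metric.ball_mem_nhds x hr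
      by_cases hp : ∃ y ∈ Metric.ball x r, 0 < ψ y
      · left
        obtain ⟨y, hy, hy0⟩ := hp
        refine mem_of_superset hb fun z hz => ?_
        by_contra hz0
        have hz0 : ψ z < 0 := not_le.1 hz0
        have hy' : y ∈ Metric.ball x r \ {x} := ⟨hy, fun e => by
          rw [Set.mem_singleton_iff] at e; rw [e, h] at hy0; exact lt_irrefl _ hy0⟩
        have hz' : z ∈ Metric.ball x r \ {x} := ⟨hz, fun e => by
          rw [Set.mem_singleton_iff] at e; rw [e, h] at hz0; exact lt_irrefl _ hz0⟩
        obtain ⟨w, hw, hw0⟩ := hpc.ordConnected.out (Set.mem_image_of_mem ψ hz')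
          (Set.mem_image_of_mem ψ hy') ⟨hz0.le, hy0.le⟩
        exact hnz w hw.1 hw.2 hw0
      · right
        push Not at hp
        exact mem_of_superset hb hp
    · left
      exact ((hca x hx).eventually (lt_mem_nhds h)).mono fun y hy => le_of_lt hy
  have hdis : ¬ (Ω ∩ ({x | ∀ᶠ y in 𝓝 x, 0 ≤ ψ y} ∩ {x | ∀ᶠ y in 𝓝 x, ψ y ≤ 0})).Nonempty := by
    rintro ⟨x, hx, h1, h2⟩
    have h3 : ∀ᶠ y in 𝓝 x, ψ y = 0 := by
      filter_upwards [h1, h2] with y a b using le_antisymm b a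
    obtain ⟨V, hV, hVi⟩ := hiso x hx h3.self_of_nhds
    have h4 : ∀ᶠ y in 𝓝 x, y = x := by
      filter_upwards [h3, hV, hΩo.mem_nhds hx] with y a b c using hVi y ⟨b, c⟩ a
    have : ({x} : Set (ℝ × ℝ)) ∈ 𝓝 x := h4
    exact not_isOpen_singleton x (isOpen_singleton_iff_nhds_eq_pure x |>.2
      (le_antisymm (by simpa using this) (pure_le_nhds x)))
  by_contra hcon
  push Not at hcon
  obtain ⟨⟨a, ha, ha0⟩, b, hb, hb0⟩ := hcon
  refine hdis (hΩc _ _ hA hB hcov ⟨b, hb, ?_⟩ ⟨a, ha, ?_⟩)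
  · exact ((hca b hb).eventually (lt_mem_nhds hb0)).mono fun y hy => le_of_lt hy
  · exact ((hca a ha).eventually (gt_mem_nhds ha0)).mono fun y hy => le_of_lt hy

lemma frontier_not_countable (Ω : Set (ℝ × ℝ)) (hΩo : IsOpen Ω) (hne : Ω.Nonempty)
    (hb : Bornology.IsBounded Ω) : ¬ (frontier Ω).Countable := by
  intro hc
  have h1 := (hc.isConnected_compl_of_one_lt_rank rank2).isPreconnected
  have hunb : ¬ Bornology.IsBounded (Set.univ : Set (ℝ × ℝ)) := NormedSpace.unbounded_univ ℝ _
  obtain ⟨x, hx⟩ : ∃ x, x ∉ closure Ω := by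
    by_contra hcon
    push Not at hcon
    exact hunb (hb.closure.subset fun x _ => hcon x)
  obtain ⟨a, ha⟩ := hne
  have hfr : frontier Ω = closure Ω \ Ω := hΩo.frontier_eq
  obtain ⟨z, _, hz1, hz2⟩ := h1 Ω (closure Ω)ᶜ hΩo isClosed_closure.isOpen_compl
    (fun y hy => by
      by_cases h : y ∈ closure Ω
      · left; by_contra h'; exact hy (hfr ▸ ⟨h, h'⟩)
      · right; exact h)
    ⟨a, fun h => by rw [hfr] at h; exact h.2 ha, ha⟩
    ⟨x, fun h => by rw [hfr] at h; exact hx h.1, hx⟩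
  exact hz2 (subset_closure hz1)

theorem stmt15 (ΩΓ : Set (ℝ × ℝ)) (hΩo : IsOpen ΩΓ) (hΩne : ΩΓ.Nonempty)
    (hΩb : Bornology.IsBounded ΩΓ) (hΩc : IsConnected ΩΓ)
    (U : Set (ℝ × ℝ)) (hUo : IsOpen U) (hUcl : closure ΩΓ ⊆ U)
    (ψ : ℝ × ℝ → ℝ) (hψ : AnalyticOnNhd ℝ ψ U)
    (F : ℝ → ℝ) (hFc : Continuous F)
    (heq : ∀ x ∈ ΩΓ, lap ψ x = F (ψ x))
    (hbd0 : ∀ x ∈ frontier ΩΓ, ψ x = 0)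
    (hbd1 : ∀ x ∈ frontier ΩΓ, fderiv ℝ ψ x = 0)
    (hbddeg : ∀ x ∈ frontier ΩΓ, 3 ≤ degVan ψ x)
    (hiso : ∀ x ∈ ΩΓ, ψ x = 0 → fderiv ℝ ψ x = 0 →
      ∃ V ∈ nhds x, ∀ y ∈ V ∩ ΩΓ, ψ y = 0 → fderiv ℝ ψ y = 0 → y = x) :
    (∀ x ∈ ΩΓ, 0 ≤ ψ x) ∨ (∀ x ∈ ΩΓ, ψ x ≤ 0) := by
  have hΩU : ΩΓ ⊆ U := subset_closure.trans hUcl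
  by_cases hreg : ∀ x ∈ ΩΓ, ψ x = 0 → fderiv ℝ ψ x = 0
  · refine sign_of_no_regular ΩΓ hΩo hΩc.isPreconnected ψ (hψ.continuousOn.mono hΩU) ?_
    intro x hx hx0
    obtain ⟨V, hV, h⟩ := hiso x hx hx0 (hreg x hx hx0)
    exact ⟨V, hV, fun y hy hy0 => h y hy hy0 (hreg y hy.2 hy0)⟩
  exfalso
  push Not at hreg
  obtain ⟨x0, hx0, hz, hfd⟩ := hreg
  -- F is analytic at 0
  have hFa : AnalyticAt ℝ F 0 := by
    obtain ⟨v, hv⟩ : ∃ v, fderiv ℝ ψ x0 v ≠ 0 := by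
      by_contra hcon
      push Not at hcon
      exact hfd (ContinuousLinearMap.ext hcon)
    have hx0a := hψ x0 (hΩU hx0)
    have hl : AnalyticAt ℝ (fun s : ℝ => x0 + s • v) 0 :=
      analyticAt_const.fun_add (analyticAt_id.fun_smul analyticAt_const)
    have e0 : x0 + (0 : ℝ) • v = x0 := by simp
    have hg : AnalyticAt ℝ (fun s : ℝ => ψ (x0 + s • v)) 0 :=
      AnalyticAt.fun_comp (by rwa [e0]) hl
    have hld : HasDerivAt (fun s : ℝ => x0 + s • v) v 0 := by
      have := ((hasDerivAt_id (0 : ℝ)).smul_const v).const_add x0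
      simpa using! this
    have hgd : HasDerivAt (fun s : ℝ => ψ (x0 + s • v)) (fderiv ℝ ψ x0 v) 0 :=
      HasFDerivAt.comp_hasDerivAt (x := (0 : ℝ)) (by
        rw [e0]; exact hx0a.differentiableAt.hasFDerivAt) hld
    have := analyticAt_comp_iff_of_deriv_ne_zero (g := F) hg (by rw [hgd.deriv]; exact hv)
    simp only [e0, hz] at this
    rw [← this]
    have hk : AnalyticAt ℝ (fun s : ℝ => lap ψ (x0 + s • v)) 0 :=
      AnalyticAt.fun_comp (by rw [e0]; exact an_lap hx0a) hl
    refine hk.congr ?_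
    have hc : ∀ᶠ s in 𝓝 (0 : ℝ), x0 + s • v ∈ ΩΓ :=
      hl.continuousAt.eventually (by simp only [e0]; exact hΩo.mem_nhds hx0)
    filter_upwards [hc] with s hs
    exact heq _ hs
  -- boundary points are isolated
  have hF0 : ∀ p ∈ frontier ΩΓ, F 0 = 0 := by
    intro p hp
    have hpc : p ∈ closure ΩΓ := frontier_subset_closure hp
    have hpa := hψ p (hUcl hpc)
    have hlap : lap ψ p = 0 := by
      obtain ⟨n, hn⟩ : ∃ n, degVan ψ p = n + 3 := ⟨degVan ψ p - 3, by have := hbddeg p hp; omega⟩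
      have : iteratedFDeriv ℝ 2 ψ p = 0 := by
        by_contra hcon
        exact Nat.notMem_of_lt_sInf (m := 2) (s := {k | 1 ≤ k ∧ iteratedFDeriv ℝ k ψ p ≠ 0})
          (by unfold degVan at hn; omega) ⟨by norm_num, hcon⟩
      simp [lap, this]
    have hne : (𝓝[ΩΓ] p).NeBot := mem_closure_iff_nhdsWithin_neBot.1 hpc
    have t1 : Tendsto (lap ψ) (𝓝[ΩΓ] p) (𝓝 0) := by
      have := (an_lap hpa).continuousAt.tendsto.mono_left (nhdsWithin_le_nhds (s := ΩΓ))
      rwa [hlap] at this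
    have t2 : Tendsto (fun y => F (ψ y)) (𝓝[ΩΓ] p) (𝓝 (F 0)) := by
      have h1 := hpa.continuousAt.tendsto.mono_left (nhdsWithin_le_nhds (s := ΩΓ))
      rw [hbd0 p hp] at h1
      exact (hFc.tendsto 0).comp h1
    refine tendsto_nhds_unique (t2.congr' ?_) t1
    filter_upwards [self_mem_nhdsWithin] with y hy using (heq y hy).symm
  have hisol : ∀ p ∈ frontier ΩΓ, ∀ᶠ y in 𝓝 p, fderiv ℝ ψ y = 0 → y = p := by
    intro p hp
    have hpc : p ∈ closure ΩΓ := frontier_subset_closure hp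
    have hpa := hψ p (hUcl hpc)
    have hp0 := hbd0 p hp
    have hds : AnalyticAt ℝ (dslope F 0) 0 := by
      obtain ⟨P, hP⟩ := hFa
      exact ⟨_, hP.has_fpower_series_dslope_fslope⟩
    refine isolated ψ p hpa (fun y => dslope F 0 (ψ y))
      (AnalyticAt.fun_comp (by rwa [hp0]) hpa) ?_ hp0 (hbddeg p hp)
    have hFψ : AnalyticAt ℝ (fun y => F (ψ y)) p := AnalyticAt.fun_comp (by rwa [hp0]) hpa
    obtain ⟨r, hr, hrb⟩ := Metric.eventually_nhds_iff_ball.1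
      ((an_lap hpa).eventually_analyticAt.and hFψ.eventually_analyticAt)
    obtain ⟨z, hzΩ, hzp⟩ := Metric.mem_closure_iff.1 hpc r hr
    have hzb : z ∈ Metric.ball p r := by rw [Metric.mem_ball, dist_comm]; exact hzp
    have hE : Set.EqOn (lap ψ) (fun y => F (ψ y)) (Metric.ball p r) := by
      refine AnalyticOnNhd.eqOn_of_preconnected_of_eventuallyEq (𝕜 := ℝ)
        (fun y hy => (hrb y hy).1) (fun y hy => (hrb y hy).2)
        (convex_ball p r).isPreconnected hzb ?_
      filter_upwards [hΩo.mem_nhds hzΩ] with y hy using heq y hy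
    filter_upwards [Metric.ball_mem_nhds p hr] with y hy
    rw [hE hy]
    have := sub_smul_dslope F 0 (ψ y)
    rw [hF0 p hp] at this
    simpa using this.symm
  apply frontier_not_countable ΩΓ hΩo hΩne hΩb
  refine Set.Finite.countable (IsCompact.finite ?_ ?_)
  · exact Metric.isCompact_of_isClosed_isBounded isClosed_frontier
      (hΩb.closure.subset frontier_subset_closure)
  · refine IsDiscrete.of_nhdsWithin fun p hp => ?_
    rw [le_pure_iff]
    filter_upwards [mem_nhdsWithin_of_mem_nhds (hisol p hp), self_mem_nhdsWithin] with y hy hyf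
    exact hy (hbd1 y hyf)
end
end
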